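/- arXiv:2209.10675 — 2 statements merged into one kernel-verified Lean document; each statement's English description precedes it below -/
import Mathlib

section
/- Let D₁, …, D_T ∈ ℝ^{n×n}, let t̂ = argmin_{1 ≤ t ≤ T} ‖𝒜_val(D_t) + e‖₂ and t̃ = argmin_{1 ≤ t ≤ T} ‖D_t‖_F. Assume that (1 − δ_val)·(‖D_t‖_F² + σ²) ≤ (1/m_val)·‖𝒜_val(D_t) + e‖₂² ≤ (1 + δ_val)·(‖D_t‖_F² + σ²) for every t = 1, …, T, where 0 < δ_val < 1. Then ‖D_{t̂}‖_F² ≤ ((1 + δ_val)/(1 − δ_val))·‖D_{t̃}‖_F² + (2δ_val/(1 − δ_val))·σ². -/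
open scoped BigOperators
open Matrix MeasureTheory ProbabilityTheory

noncomputable section

/-- Euclidean (ℓ²) norm of a vector in `ℝ^n`. -/
def vecNorm {n : ℕ} (v : Fin n → ℝ) : ℝ := Real.sqrt (∑ i, (v i) ^ 2)

/-- Frobenius norm of a matrix. -/
def frobNorm {m n : ℕ} (A : Matrix (Fin m) (Fin n) ℝ) : ℝ :=
  Real.sqrt (∑ i, ∑ j, (A i j) ^ 2)

/-- The `k`-th largest singular value of a matrix, via the Courant–Fischer
min-max characterization. -/
def singVal {m n : ℕ} (A : Matrix (Fin m) (Fin n) ℝ) (k : ℕ) : ℝ :=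
  sSup {c : ℝ | 0 ≤ c ∧ ∃ V : Submodule ℝ (Fin n → ℝ),
    Module.finrank ℝ V = k ∧ ∀ x ∈ V, c * vecNorm x ≤ vecNorm (A.mulVec x)}

/-- Spectral (operator) norm: the largest singular value. -/
def specNorm {m n : ℕ} (A : Matrix (Fin m) (Fin n) ℝ) : ℝ := singVal A 1

/-- Nuclear norm: the sum of all singular values. -/
def nucNorm {m n : ℕ} (A : Matrix (Fin m) (Fin n) ℝ) : ℝ :=
  ∑ k ∈ Finset.Icc 1 (min m n), singVal A k

/-- Apply the validation sensing matrices `A i` to a matrix `D`: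
`(𝒜_val(D))_i = ⟨A_i, D⟩`. -/
def applyVal {n mval : ℕ} (A : Fin mval → Matrix (Fin n) (Fin n) ℝ)
    (D : Matrix (Fin n) (Fin n) ℝ) : Fin mval → ℝ :=
  fun i => ∑ k, ∑ l, A i k l * D k l

/-- If the validation measurements are an approximate isometry
on the matrices `D_1, …, D_T` (shifted by the noise level `σ²`), then the
iterate selected by the smallest validation loss is almost as good as the best
iterate. -/
theorem validation_selection {n mval T : ℕ}
    (A : Fin mval → Matrix (Fin n) (Fin n) ℝ) (e : Fin mval → ℝ)
    (D : Fin T → Matrix (Fin n) (Fin n) ℝ) (σ δval : ℝ)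
    (hδ0 : 0 < δval) (hδ1 : δval < 1)
    (that ttil : Fin T)
    (hhat : ∀ t : Fin T,
      vecNorm (fun i => applyVal A (D that) i + e i) ≤
        vecNorm (fun i => applyVal A (D t) i + e i))
    (htil : ∀ t : Fin T, frobNorm (D ttil) ≤ frobNorm (D t))
    (hsandwich : ∀ t : Fin T,
      (1 - δval) * (frobNorm (D t) ^ 2 + σ ^ 2) ≤
          vecNorm (fun i => applyVal A (D t) i + e i) ^ 2 / mval ∧
        vecNorm (fun i => applyVal A (D t) i + e i) ^ 2 / mval ≤
          (1 + δval) * (frobNorm (D t) ^ 2 + σ ^ 2)) :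
    frobNorm (D that) ^ 2 ≤
      (1 + δval) / (1 - δval) * frobNorm (D ttil) ^ 2 +
        2 * δval / (1 - δval) * σ ^ 2 := by
  have hpos : 0 < 1 - δval := by linarith
  have hloss : vecNorm (fun i => applyVal A (D that) i + e i) ^ 2 / mval ≤
      vecNorm (fun i => applyVal A (D ttil) i + e i) ^ 2 / mval := by
    have h0 : 0 ≤ vecNorm (fun i => applyVal A (D that) i + e i) := Real.sqrt_nonneg _
    have := hhat ttil
    gcongr
  have key := ((hsandwich that).1.trans hloss).trans (hsandwich ttil).2
  have hrhs : (1 + δval) / (1 - δval) * frobNorm (D ttil) ^ 2 +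
      2 * δval / (1 - δval) * σ ^ 2 =
      ((1 + δval) * frobNorm (D ttil) ^ 2 + 2 * δval * σ ^ 2) / (1 - δval) := by
    ring
  rw [hrhs, le_div_iff₀ hpos]
  linarith
end
end

section
/- (Signal-increasing phase.) Assume 𝒜 satisfies (2r*, δ)-RIP with δ ≤ c·κ_f^{-4}·r*^{-1/2}, ‖E‖ ≤ c·κ_f^{-2}·σ_min(X♮), μ ≤ c·κ_f^{-2}·‖U♮‖^{-2}, and r ≥ r*. Let γ > 0 and choose t⋆ such that σ_min(U_{t⋆}W_{t⋆}) ≥ γ. Assume additionally ‖U_{t⋆}W_{t⋆,⊥}‖ ≤ 2γ, ‖U_{t⋆}‖ ≤ 3‖U♮‖, γ ≤ c₁·σ_min(U♮)/(min{r,n}·κ_f²), and ‖V_{X♮⊥}ᵀV_{U_{t⋆}W_{t⋆}}‖ ≤ c₂·κ_f^{-2} for sufficiently small universal constants c₁, c₂ > 0. Set t₁ = min{ t ≥ t⋆ : σ_min(V_{X♮}ᵀU_t) ≥ σ_min(U♮)/√10 }. Then t₁ is finite with t₁ − t⋆ ≤ (16/(μ·σ_min(U♮)²))·ln( √(5/2)·σ_min(U♮)/γ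 ), and for every t ∈ [t⋆, t₁]: σ_min(V_{X♮}ᵀU_t) ≥ (1/2)·(1 + (1/8)·μ·σ_min(U♮)²)^{t−t⋆}·γ, ‖U_tW_{t,⊥}‖ ≤ 2·(1 + 80·μ·c₂·σ_min(U♮)²)^{t−t⋆}·γ, ‖U_t‖ ≤ 3‖U♮‖, and ‖V_{X♮⊥}ᵀV_{U_tW_t}‖ ≤ c₂·κ_f^{-2}. -/
open scoped BigOperators
open Matrix MeasureTheory ProbabilityTheory

noncomputable section

/-- Normalized `(k, δ)`-restricted isometry property (the `1/√m` factor is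
absorbed into `𝒜`). -/
def RIPn {n m : ℕ} (calA : Matrix (Fin n) (Fin n) ℝ →ₗ[ℝ] (Fin m → ℝ)) (k : ℕ) (δ : ℝ) : Prop :=
  ∀ X : Matrix (Fin n) (Fin n) ℝ, X.rank ≤ k →
    (1 - δ) * frobNorm X ^ 2 ≤ vecNorm (calA X) ^ 2 ∧
      vecNorm (calA X) ^ 2 ≤ (1 + δ) * frobNorm X ^ 2

/-- `calAstar` is the adjoint of `calA` with respect to the trace inner product
on `ℝ^{n×n}` and the dot product on `ℝ^m`. -/
def IsAdjointPair' {n m : ℕ} (calA : Matrix (Fin n) (Fin n) ℝ →ₗ[ℝ] (Fin m → ℝ))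
    (calAstar : (Fin m → ℝ) →ₗ[ℝ] Matrix (Fin n) (Fin n) ℝ) : Prop :=
  ∀ (X : Matrix (Fin n) (Fin n) ℝ) (v : Fin m → ℝ),
    calA X ⬝ᵥ v = ∑ i, ∑ j, X i j * calAstar v i j

section Auxiliary

open scoped Matrix.Norms.L2Operator

/-! ### Euclidean norm of vectors and operator norm of matrices -/

lemma vecNorm_eq_norm {n : ℕ} (v : Fin n → ℝ) : vecNorm v = ‖WithLp.toLp 2 v‖ := by
  simp [vecNorm, EuclideanSpace.norm_eq, sq_abs]

lemma vecNorm_nonneg {n : ℕ} (v : Fin n → ℝ) : 0 ≤ vecNorm v := Real.sqrt_nonneg _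

lemma vecNorm_sq {n : ℕ} (v : Fin n → ℝ) : vecNorm v ^ 2 = v ⬝ᵥ v := by
  rw [vecNorm, Real.sq_sqrt (Finset.sum_nonneg fun i _ => sq_nonneg _)]
  simp [dotProduct, sq]

lemma vecNorm_zero {n : ℕ} : vecNorm (0 : Fin n → ℝ) = 0 := by
  simp [vecNorm]

lemma vecNorm_eq_zero {n : ℕ} {v : Fin n → ℝ} : vecNorm v = 0 ↔ v = 0 := by
  rw [vecNorm_eq_norm, norm_eq_zero]
  exact WithLp.toLp_eq_zero 2

lemma vecNorm_pos {n : ℕ} {v : Fin n → ℝ} (hv : v ≠ 0) : 0 < vecNorm v :=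
  (vecNorm_nonneg v).lt_of_ne fun h => hv (vecNorm_eq_zero.1 h.symm)

lemma vecNorm_add_le {n : ℕ} (v w : Fin n → ℝ) : vecNorm (v + w) ≤ vecNorm v + vecNorm w := by
  simpa only [vecNorm_eq_norm, WithLp.toLp_add] using norm_add_le _ _

lemma vecNorm_sub_le_add {n : ℕ} (v w : Fin n → ℝ) :
    vecNorm v - vecNorm w ≤ vecNorm (v + w) := by
  simpa only [vecNorm_eq_norm, WithLp.toLp_add] using norm_sub_le_norm_add _ _

lemma vecNorm_smul {n : ℕ} (a : ℝ) (v : Fin n → ℝ) : vecNorm (a • v) = |a| * vecNorm v := by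
  simp only [vecNorm_eq_norm, WithLp.toLp_smul, norm_smul, Real.norm_eq_abs]

lemma dotProduct_le_vecNorm {n : ℕ} (v w : Fin n → ℝ) : v ⬝ᵥ w ≤ vecNorm v * vecNorm w := by
  have := real_inner_le_norm (WithLp.toLp 2 w) (WithLp.toLp 2 v)
  rw [EuclideanSpace.inner_toLp_toLp] at this
  simp only [vecNorm_eq_norm]
  simpa [mul_comm] using this

lemma dotProduct_mulVec_transpose {m n : ℕ} (A : Matrix (Fin m) (Fin n) ℝ) (x : Fin n → ℝ)
    (y : Fin m → ℝ) : y ⬝ᵥ A *ᵥ x = Aᵀ *ᵥ y ⬝ᵥ x := by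
  rw [dotProduct_mulVec, mulVec_transpose]

lemma vecNorm_mulVec_sq {m n : ℕ} (A : Matrix (Fin m) (Fin n) ℝ) (x : Fin n → ℝ) :
    vecNorm (A *ᵥ x) ^ 2 = x ⬝ᵥ (Aᵀ * A) *ᵥ x := by
  rw [vecNorm_sq, dotProduct_mulVec_transpose, mulVec_mulVec, dotProduct_comm]

lemma vecNorm_mulVec_le {m n : ℕ} (A : Matrix (Fin m) (Fin n) ℝ) (x : Fin n → ℝ) :
    vecNorm (A *ᵥ x) ≤ ‖A‖ * vecNorm x := by
  simpa [vecNorm_eq_norm] using Matrix.l2_opNorm_mulVec A (WithLp.toLp 2 x)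

lemma norm_le_of_vecNorm_le {m n : ℕ} {A : Matrix (Fin m) (Fin n) ℝ} {c : ℝ} (hc : 0 ≤ c)
    (h : ∀ x, vecNorm (A *ᵥ x) ≤ c * vecNorm x) : ‖A‖ ≤ c := by
  rw [Matrix.l2_opNorm_def]
  refine ContinuousLinearMap.opNorm_le_bound _ hc fun x => ?_
  have := h x.ofLp
  rw [vecNorm_eq_norm, vecNorm_eq_norm] at this
  exact this

lemma norm_transpose_eq {m n : ℕ} (A : Matrix (Fin m) (Fin n) ℝ) : ‖Aᵀ‖ = ‖A‖ := by
  rw [← Matrix.l2_opNorm_conjTranspose A, conjTranspose_eq_transpose_of_trivial]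

lemma l2_norm_mul_le_of_le {l m n : ℕ} {A : Matrix (Fin l) (Fin m) ℝ} {B : Matrix (Fin m) (Fin n) ℝ}
    {a b : ℝ} (hA : ‖A‖ ≤ a) (hB : ‖B‖ ≤ b) : ‖A * B‖ ≤ a * b :=
  (Matrix.l2_opNorm_mul A B).trans
    (mul_le_mul hA hB (norm_nonneg _) ((norm_nonneg _).trans hA))

lemma norm_add_le_add {m n : ℕ} {A B : Matrix (Fin m) (Fin n) ℝ}
    {a b : ℝ} (hA : ‖A‖ ≤ a) (hB : ‖B‖ ≤ b) : ‖A + B‖ ≤ a + b :=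
  (norm_add_le A B).trans (add_le_add hA hB)

lemma norm_sub_le_add {m n : ℕ} {A B : Matrix (Fin m) (Fin n) ℝ}
    {a b : ℝ} (hA : ‖A‖ ≤ a) (hB : ‖B‖ ≤ b) : ‖A - B‖ ≤ a + b :=
  (norm_sub_le A B).trans (add_le_add hA hB)

lemma norm_smul_le_of_le {m n : ℕ} {A : Matrix (Fin m) (Fin n) ℝ} {c a : ℝ} (hc : 0 ≤ c)
    (hA : ‖A‖ ≤ a) : ‖c • A‖ ≤ c * a := by
  rw [norm_smul, Real.norm_of_nonneg hc]
  exact mul_le_mul_of_nonneg_left hA hc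

lemma norm_le_one_of_transpose_mul_self {m n : ℕ} {A : Matrix (Fin m) (Fin n) ℝ}
    (h : Aᵀ * A = 1) : ‖A‖ ≤ 1 := by
  refine norm_le_of_vecNorm_le zero_le_one fun x => ?_
  refine (sq_le_sq₀ (vecNorm_nonneg _) (mul_nonneg zero_le_one (vecNorm_nonneg x))).1 ?_
  rw [vecNorm_mulVec_sq, h, one_mulVec, one_mul, vecNorm_sq]

lemma vecNorm_mulVec_le_of_le {m n : ℕ} {A : Matrix (Fin m) (Fin n) ℝ} {a : ℝ} (hA : ‖A‖ ≤ a)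
    (x : Fin n → ℝ) : vecNorm (A *ᵥ x) ≤ a * vecNorm x :=
  (vecNorm_mulVec_le A x).trans (mul_le_mul_of_nonneg_right hA (vecNorm_nonneg x))

lemma mulVec_surjective_of_le {n : ℕ} {A : Matrix (Fin n) (Fin n) ℝ} {c : ℝ} (hc : 0 < c)
    (h : ∀ x, c * vecNorm x ≤ vecNorm (A *ᵥ x)) (y : Fin n → ℝ) : ∃ x, A *ᵥ x = y := by
  have hinj : Function.Injective A.mulVecLin := by
    rw [injective_iff_map_eq_zero]
    intro x hx
    have h1 := h x
    rw [mulVecLin_apply] at hx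
    rw [hx, vecNorm_zero] at h1
    by_contra hne
    have := mul_pos hc (vecNorm_pos hne)
    linarith
  obtain ⟨x, hx⟩ := LinearMap.surjective_of_injective hinj y
  exact ⟨x, hx⟩

/-! ### Singular values -/

lemma specNorm_eq_norm {m n : ℕ} (A : Matrix (Fin m) (Fin n) ℝ) : specNorm A = ‖A‖ := by
  unfold specNorm singVal
  have hub : ∀ c ∈ {c : ℝ | 0 ≤ c ∧ ∃ V : Submodule ℝ (Fin n → ℝ),
      Module.finrank ℝ V = 1 ∧ ∀ x ∈ V, c * vecNorm x ≤ vecNorm (A.mulVec x)}, c ≤ ‖A‖ := by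
    rintro c ⟨-, V, hV, h⟩
    obtain ⟨⟨x, hxV⟩, hx, -⟩ := finrank_eq_one_iff'.1 hV
    have hx0 : x ≠ 0 := fun h0 => hx (by simp [h0])
    exact le_of_mul_le_mul_right ((h x hxV).trans (vecNorm_mulVec_le A x)) (vecNorm_pos hx0)
  refine le_antisymm (Real.sSup_le hub (norm_nonneg _)) ?_
  refine norm_le_of_vecNorm_le (Real.sSup_nonneg fun c hc => hc.1) fun x => ?_
  by_cases hx : x = 0
  · simp [hx, vecNorm_zero]
  rw [← div_le_iff₀ (vecNorm_pos hx)]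
  refine le_csSup ⟨_, hub⟩ ⟨div_nonneg (vecNorm_nonneg _) (vecNorm_nonneg _),
    Submodule.span ℝ {x}, finrank_span_singleton hx, ?_⟩
  intro y hy
  obtain ⟨a, rfl⟩ := Submodule.mem_span_singleton.1 hy
  rw [mulVec_smul, vecNorm_smul, vecNorm_smul]
  have := vecNorm_pos hx
  field_simp
  exact le_rfl

lemma singVal_nonneg {m n : ℕ} (A : Matrix (Fin m) (Fin n) ℝ) (k : ℕ) : 0 ≤ singVal A k :=
  Real.sSup_nonneg fun _ hc => hc.1

lemma singVal_zero {m n : ℕ} (A : Matrix (Fin m) (Fin n) ℝ) : singVal A 0 = 0 := by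
  refine Real.sSup_of_not_bddAbove fun ⟨b, hb⟩ => ?_
  have : |b| + 1 ≤ b := hb ⟨by positivity, ⊥, by simp, by
    intro x hx
    rw [(Submodule.mem_bot ℝ).1 hx]
    simp [vecNorm_zero]⟩
  linarith [le_abs_self b]

lemma le_norm_of_finrank {m n k : ℕ} (hk : 0 < k) {A : Matrix (Fin m) (Fin n) ℝ} {c : ℝ}
    {V : Submodule ℝ (Fin n → ℝ)} (hV : Module.finrank ℝ V = k)
    (h : ∀ x ∈ V, c * vecNorm x ≤ vecNorm (A *ᵥ x)) : c ≤ ‖A‖ := by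
  have : Nontrivial V := Module.nontrivial_of_finrank_pos (R := ℝ) (by omega)
  obtain ⟨⟨x, hxV⟩, hx⟩ := exists_ne (0 : V)
  have hx0 : x ≠ 0 := fun h0 => hx (by simp [h0])
  exact le_of_mul_le_mul_right ((h x hxV).trans (vecNorm_mulVec_le A x)) (vecNorm_pos hx0)

lemma le_singVal {m n k : ℕ} (hk : 0 < k) {A : Matrix (Fin m) (Fin n) ℝ} {c : ℝ} (hc : 0 ≤ c)
    {V : Submodule ℝ (Fin n → ℝ)} (hV : Module.finrank ℝ V = k)
    (h : ∀ x ∈ V, c * vecNorm x ≤ vecNorm (A *ᵥ x)) : c ≤ singVal A k :=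
  le_csSup ⟨‖A‖, by rintro _ ⟨-, V, hV, h⟩; exact le_norm_of_finrank hk hV h⟩ ⟨hc, V, hV, h⟩

lemma singVal_mul_vecNorm_le {m k : ℕ} (A : Matrix (Fin m) (Fin k) ℝ) (x : Fin k → ℝ) :
    singVal A k * vecNorm x ≤ vecNorm (A *ᵥ x) := by
  by_cases hx : x = 0
  · simp [hx, vecNorm_zero]
  rw [← le_div_iff₀ (vecNorm_pos hx)]
  refine Real.sSup_le ?_ (div_nonneg (vecNorm_nonneg _) (vecNorm_nonneg _))
  rintro c ⟨-, V, hV, h⟩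
  rw [le_div_iff₀ (vecNorm_pos hx)]
  have : V = ⊤ := Submodule.eq_top_of_finrank_eq (by simpa using hV)
  exact h x (this ▸ Submodule.mem_top)

lemma exists_mem_mulVec_eq {k n : ℕ} {A : Matrix (Fin k) (Fin n) ℝ} {c : ℝ} (hc : 0 < c)
    {V : Submodule ℝ (Fin n → ℝ)} (hV : Module.finrank ℝ V = k)
    (h : ∀ x ∈ V, c * vecNorm x ≤ vecNorm (A *ᵥ x)) (y : Fin k → ℝ) : ∃ x ∈ V, A *ᵥ x = y := by
  have hinj : Function.Injective (A.mulVecLin.domRestrict V) := by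
    rw [injective_iff_map_eq_zero]
    rintro ⟨x, hxV⟩ hx
    have h1 := h x hxV
    rw [LinearMap.domRestrict_apply, mulVecLin_apply] at hx
    rw [hx, vecNorm_zero] at h1
    by_contra hne
    have hx0 : x ≠ 0 := fun h0 => hne (by simp [h0])
    have := mul_pos hc (vecNorm_pos hx0)
    linarith
  obtain ⟨x, hx⟩ := (LinearMap.injective_iff_surjective_of_finrank_eq_finrank
    (by simpa using hV)).1 hinj y
  exact ⟨x, x.2, hx⟩

lemma le_vecNorm_transpose_mulVec {k n : ℕ} {A : Matrix (Fin k) (Fin n) ℝ} {c : ℝ} (hc : 0 < c)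
    {V : Submodule ℝ (Fin n → ℝ)} (hV : Module.finrank ℝ V = k)
    (h : ∀ x ∈ V, c * vecNorm x ≤ vecNorm (A *ᵥ x)) (y : Fin k → ℝ) :
    c * vecNorm y ≤ vecNorm (Aᵀ *ᵥ y) := by
  obtain ⟨x, hxV, rfl⟩ := exists_mem_mulVec_eq hc hV h y
  set y := A *ᵥ x
  have h1 : vecNorm y ^ 2 ≤ vecNorm (Aᵀ *ᵥ y) * vecNorm x := by
    rw [vecNorm_sq]
    conv_lhs => rw [show y ⬝ᵥ y = y ⬝ᵥ A *ᵥ x from rfl, dotProduct_mulVec_transpose]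
    exact dotProduct_le_vecNorm _ _
  have h2 := h x hxV
  have h3 := vecNorm_nonneg (Aᵀ *ᵥ y)
  rcases (vecNorm_nonneg y).eq_or_lt with h0 | h0
  · rw [← h0, mul_zero]; exact h3
  · refine le_of_mul_le_mul_right ?_ h0
    calc c * vecNorm y * vecNorm y = c * vecNorm y ^ 2 := by ring
      _ ≤ c * (vecNorm (Aᵀ *ᵥ y) * vecNorm x) := by gcongr
      _ = vecNorm (Aᵀ *ᵥ y) * (c * vecNorm x) := by ring
      _ ≤ _ := by gcongr

lemma le_vecNorm_transpose_mulVec_of_square {k : ℕ} {A : Matrix (Fin k) (Fin k) ℝ} {c : ℝ}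
    (hc : 0 < c) (h : ∀ x, c * vecNorm x ≤ vecNorm (A *ᵥ x)) (y : Fin k → ℝ) :
    c * vecNorm y ≤ vecNorm (Aᵀ *ᵥ y) :=
  le_vecNorm_transpose_mulVec hc (V := ⊤) (by simp) (fun x _ => h x) y

lemma le_singVal_of_transpose {k n : ℕ} (hk : 0 < k) {A : Matrix (Fin k) (Fin n) ℝ} {c : ℝ}
    (hc : 0 < c) (h : ∀ y, c * vecNorm y ≤ vecNorm (Aᵀ *ᵥ y)) : c ≤ singVal A k := by
  have hinj : Function.Injective Aᵀ.mulVecLin := by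
    rw [injective_iff_map_eq_zero]
    intro x hx
    have h1 := h x
    rw [mulVecLin_apply] at hx
    rw [hx, vecNorm_zero] at h1
    by_contra hne
    have := mul_pos hc (vecNorm_pos hne)
    linarith
  refine le_singVal hk hc.le (V := LinearMap.range Aᵀ.mulVecLin)
    (by rw [LinearMap.finrank_range_of_inj hinj]; simp) ?_
  rintro _ ⟨y, rfl⟩
  rw [mulVecLin_apply]
  rcases (vecNorm_nonneg y).eq_or_lt with h0 | h0
  · rw [vecNorm_eq_zero.1 h0.symm]
    simp [vecNorm_zero]
  refine le_of_mul_le_mul_right ?_ h0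
  have h1 : vecNorm (Aᵀ *ᵥ y) ^ 2 ≤ vecNorm y * vecNorm (A *ᵥ Aᵀ *ᵥ y) := by
    rw [vecNorm_sq, ← dotProduct_mulVec_transpose]
    exact dotProduct_le_vecNorm _ _
  have h2 := vecNorm_nonneg (Aᵀ *ᵥ y)
  calc c * vecNorm (Aᵀ *ᵥ y) * vecNorm y = (c * vecNorm y) * vecNorm (Aᵀ *ᵥ y) := by ring
    _ ≤ vecNorm (Aᵀ *ᵥ y) * vecNorm (Aᵀ *ᵥ y) := by gcongr; exact h y
    _ = vecNorm (Aᵀ *ᵥ y) ^ 2 := by ring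
    _ ≤ _ := by linarith

lemma singVal_mul_transpose_le {n k : ℕ} (A : Matrix (Fin n) (Fin k) ℝ) (hk : 0 < k) :
    singVal (A * Aᵀ) k ≤ singVal A k ^ 2 := by
  refine Real.sSup_le ?_ (sq_nonneg _)
  rintro c ⟨hc, V, hV, h⟩
  rcases hc.eq_or_lt with rfl | hc
  · positivity
  have hA : ∀ x ∈ V, c / (‖A‖ + 1) * vecNorm x ≤ vecNorm (Aᵀ *ᵥ x) := by
    intro x hx
    have h1 := h x hx
    rw [← mulVec_mulVec] at h1
    have h2 := vecNorm_mulVec_le A (Aᵀ *ᵥ x)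
    have h3 := vecNorm_nonneg (Aᵀ *ᵥ x)
    rw [div_mul_eq_mul_div, div_le_iff₀ (by positivity)]
    linarith
  suffices hs : Real.sqrt c ≤ singVal A k by
    calc c = Real.sqrt c ^ 2 := (Real.sq_sqrt hc.le).symm
      _ ≤ _ := by gcongr
  refine le_singVal hk (Real.sqrt_nonneg _) (V := ⊤) (by simp) fun y _ => ?_
  obtain ⟨x, hxV, rfl⟩ := exists_mem_mulVec_eq (by positivity) hV hA y
  refine (sq_le_sq₀ (mul_nonneg (Real.sqrt_nonneg _) (vecNorm_nonneg _)) (vecNorm_nonneg _)).1 ?_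
  rw [mul_pow, Real.sq_sqrt hc.le]
  set y := Aᵀ *ᵥ x with hy
  have h1 : vecNorm y ^ 2 ≤ vecNorm x * vecNorm (A *ᵥ y) := by
    rw [vecNorm_sq]
    conv_lhs => rw [show y ⬝ᵥ y = Aᵀ *ᵥ x ⬝ᵥ y from rfl, ← dotProduct_mulVec_transpose]
    exact dotProduct_le_vecNorm _ _
  have h2 := h x hxV
  rw [← mulVec_mulVec] at h2
  have h3 := vecNorm_nonneg (A *ᵥ y)
  calc c * vecNorm y ^ 2 ≤ c * (vecNorm x * vecNorm (A *ᵥ y)) := by gcongr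
    _ = (c * vecNorm x) * vecNorm (A *ᵥ y) := by ring
    _ ≤ vecNorm (A *ᵥ y) * vecNorm (A *ᵥ y) := by gcongr
    _ = _ := by ring

/-! ### Consequences of the restricted isometry property -/

lemma frobNorm_nonneg {m n : ℕ} (A : Matrix (Fin m) (Fin n) ℝ) : 0 ≤ frobNorm A :=
  Real.sqrt_nonneg _

lemma frobNorm_sq {m n : ℕ} (A : Matrix (Fin m) (Fin n) ℝ) :
    frobNorm A ^ 2 = ∑ i, ∑ j, A i j ^ 2 :=
  Real.sq_sqrt (Finset.sum_nonneg fun _ _ => Finset.sum_nonneg fun _ _ => sq_nonneg _)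

lemma frobNorm_sq_eq_sum_rows {m n : ℕ} (A : Matrix (Fin m) (Fin n) ℝ) :
    frobNorm A ^ 2 = ∑ i, vecNorm (A.row i) ^ 2 := by
  simp only [frobNorm_sq, vecNorm_sq, dotProduct, ← sq, Matrix.row]

lemma frobNorm_sq_eq_sum_cols {m n : ℕ} (A : Matrix (Fin m) (Fin n) ℝ) :
    frobNorm A ^ 2 = ∑ j, vecNorm (A.col j) ^ 2 := by
  rw [frobNorm_sq, Finset.sum_comm]
  simp only [vecNorm_sq, dotProduct, ← sq, Matrix.col, transpose_apply]

lemma vecNorm_single {n : ℕ} (j : Fin n) : vecNorm (Pi.single j 1 : Fin n → ℝ) = 1 := by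
  rw [vecNorm_eq_norm]
  simp

lemma frobNorm_sq_le_cols {m n : ℕ} (A : Matrix (Fin m) (Fin n) ℝ) :
    frobNorm A ^ 2 ≤ n * ‖A‖ ^ 2 := by
  rw [frobNorm_sq_eq_sum_cols]
  calc ∑ j, vecNorm (A.col j) ^ 2 ≤ ∑ _j : Fin n, ‖A‖ ^ 2 := by
        refine Finset.sum_le_sum fun j _ => ?_
        have := vecNorm_mulVec_le A (Pi.single j 1)
        rw [mulVec_single_one, vecNorm_single, mul_one] at this
        exact pow_le_pow_left₀ (vecNorm_nonneg _) this 2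
    _ = _ := by simp

lemma frobNorm_transpose {m n : ℕ} (A : Matrix (Fin m) (Fin n) ℝ) : frobNorm Aᵀ = frobNorm A := by
  unfold frobNorm
  rw [Finset.sum_comm]
  rfl

lemma frobNorm_sq_le_min {m n : ℕ} (A : Matrix (Fin m) (Fin n) ℝ) :
    frobNorm A ^ 2 ≤ (min n m : ℕ) * ‖A‖ ^ 2 := by
  rcases min_choice n m with h | h <;> rw [h]
  · exact frobNorm_sq_le_cols A
  · rw [← frobNorm_transpose, ← norm_transpose_eq]
    exact frobNorm_sq_le_cols Aᵀ

lemma frobNorm_mul_le {l k n : ℕ} (B : Matrix (Fin l) (Fin k) ℝ) (C : Matrix (Fin k) (Fin n) ℝ) :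
    frobNorm (B * C) ≤ Real.sqrt k * (‖B‖ * ‖C‖) := by
  refine (sq_le_sq₀ (frobNorm_nonneg _) (by positivity)).1 ?_
  calc frobNorm (B * C) ^ 2 = ∑ i, vecNorm ((B * C).row i) ^ 2 := frobNorm_sq_eq_sum_rows _
    _ ≤ ∑ i, (‖C‖ * vecNorm (B.row i)) ^ 2 := by
        refine Finset.sum_le_sum fun i _ => ?_
        have h := vecNorm_mulVec_le Cᵀ (B.row i)
        rw [norm_transpose_eq, mulVec_transpose] at h
        exact pow_le_pow_left₀ (vecNorm_nonneg _) h 2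
    _ = ‖C‖ ^ 2 * frobNorm B ^ 2 := by
        rw [frobNorm_sq_eq_sum_rows, Finset.mul_sum]
        simp only [mul_pow]
    _ ≤ ‖C‖ ^ 2 * (k * ‖B‖ ^ 2) := by gcongr; exact frobNorm_sq_le_cols B
    _ = _ := by rw [mul_pow, Real.sq_sqrt (Nat.cast_nonneg k)]; ring

lemma frobNorm_vecMulVec {m n : ℕ} (x : Fin m → ℝ) (y : Fin n → ℝ) :
    frobNorm (vecMulVec x y) = vecNorm x * vecNorm y := by
  refine (sq_eq_sq₀ (frobNorm_nonneg _) (mul_nonneg (vecNorm_nonneg _) (vecNorm_nonneg _))).1 ?_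
  rw [frobNorm_sq, mul_pow, vecNorm_sq, vecNorm_sq, dotProduct, dotProduct, Finset.sum_mul_sum]
  refine Finset.sum_congr rfl fun i _ => Finset.sum_congr rfl fun j _ => ?_
  rw [vecMulVec_apply]
  ring

lemma dotProduct_mulVec_eq_sum {m n : ℕ} (Z : Matrix (Fin m) (Fin n) ℝ) (x : Fin m → ℝ)
    (y : Fin n → ℝ) : x ⬝ᵥ Z *ᵥ y = ∑ i, ∑ j, vecMulVec x y i j * Z i j := by
  simp only [dotProduct, mulVec, Finset.mul_sum, vecMulVec_apply]
  exact Finset.sum_congr rfl fun i _ => Finset.sum_congr rfl fun j _ => by ring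

lemma frobNorm_add_smul_vecMulVec_sq {m n : ℕ} (Z : Matrix (Fin m) (Fin n) ℝ) (x : Fin m → ℝ)
    (y : Fin n → ℝ) (a : ℝ) :
    frobNorm (Z + a • vecMulVec x y) ^ 2 =
      frobNorm Z ^ 2 + 2 * a * (x ⬝ᵥ Z *ᵥ y) + a ^ 2 * (vecNorm x * vecNorm y) ^ 2 := by
  rw [← frobNorm_vecMulVec, dotProduct_mulVec_eq_sum]
  simp only [frobNorm_sq, Finset.mul_sum, ← Finset.sum_add_distrib]
  refine Finset.sum_congr rfl fun i _ => Finset.sum_congr rfl fun j _ => ?_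
  simp only [Matrix.add_apply, Matrix.smul_apply, smul_eq_mul]
  ring

lemma replicateCol_mul_replicateRow {m n : ℕ} (x : Fin m → ℝ) (y : Fin n → ℝ) :
    replicateCol (Fin 1) x * replicateRow (Fin 1) y = vecMulVec x y := by
  ext i j
  simp [mul_apply, vecMulVec_apply]

lemma rank_mul_add_smul_vecMulVec_le {n k : ℕ} (B : Matrix (Fin n) (Fin k) ℝ)
    (C : Matrix (Fin k) (Fin n) ℝ) (x y : Fin n → ℝ) (a : ℝ) :
    (B * C + a • vecMulVec x y).rank ≤ k + 1 := by
  have : B * C + a • vecMulVec x y =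
      fromCols B (replicateCol (Fin 1) x) * fromRows C (a • replicateRow (Fin 1) y) := by
    rw [fromCols_mul_fromRows, Matrix.mul_smul, replicateCol_mul_replicateRow]
  rw [this]
  refine (rank_mul_le_left _ _).trans ((rank_le_card_width _).trans ?_)
  simp

section RIP

variable {n m K : ℕ} {calA : Matrix (Fin n) (Fin n) ℝ →ₗ[ℝ] (Fin m → ℝ)}
  {calAstar : (Fin m → ℝ) →ₗ[ℝ] Matrix (Fin n) (Fin n) ℝ} {δ : ℝ}

lemma RIPn.nonneg (h : RIPn calA K δ) (hn : 0 < n) (hK : 1 ≤ K) : 0 ≤ δ := by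
  have e : vecNorm (Pi.single ⟨0, hn⟩ 1 : Fin n → ℝ) = 1 := vecNorm_single _
  set x : Fin n → ℝ := Pi.single ⟨0, hn⟩ 1
  have h1 := h (vecMulVec x x) ((rank_vecMulVec_le _ _).trans hK)
  rw [frobNorm_vecMulVec, e] at h1
  linarith [h1.1, h1.2]

lemma RIPn.inner_sub_le (h : RIPn calA K δ) (hδ : 0 ≤ δ) {k : ℕ} (hk : k + 1 ≤ K)
    (B : Matrix (Fin n) (Fin k) ℝ) (C : Matrix (Fin k) (Fin n) ℝ) (x y : Fin n → ℝ) :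
    calA (vecMulVec x y) ⬝ᵥ calA (B * C) - x ⬝ᵥ (B * C) *ᵥ y ≤
      δ * frobNorm (B * C) * (vecNorm x * vecNorm y) := by
  have hA : ∀ a : ℝ, vecNorm (calA (B * C + a • vecMulVec x y)) ^ 2 =
      vecNorm (calA (B * C)) ^ 2 + 2 * a * (calA (vecMulVec x y) ⬝ᵥ calA (B * C)) +
        a ^ 2 * vecNorm (calA (vecMulVec x y)) ^ 2 := by
    intro a
    simp only [vecNorm_sq, map_add, map_smul, add_dotProduct, dotProduct_add, smul_dotProduct,
      dotProduct_smul, smul_eq_mul]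
    rw [dotProduct_comm (calA (B * C)) (calA (vecMulVec x y))]
    ring
  set b := calA (vecMulVec x y) ⬝ᵥ calA (B * C) - x ⬝ᵥ (B * C) *ᵥ y with hb
  set g := vecNorm x * vecNorm y with hg
  have hg0 : 0 ≤ g := mul_nonneg (vecNorm_nonneg _) (vecNorm_nonneg _)
  have hF := frobNorm_nonneg (B * C)
  have hd := discrim_le_zero (a := 2 * δ * g ^ 2) (b := -4 * b)
    (c := 2 * δ * frobNorm (B * C) ^ 2) (fun a => by
      have h1 := (h _ ((rank_mul_add_smul_vecMulVec_le B C x y a).trans hk)).2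
      have h2 := (h _ ((rank_mul_add_smul_vecMulVec_le B C x y (-a)).trans hk)).1
      rw [hA, frobNorm_add_smul_vecMulVec_sq] at h1 h2
      rw [hb]
      nlinarith)
  rw [discrim] at hd
  refine abs_le_of_sq_le_sq' ?_ (by positivity) |>.2
  nlinarith

lemma norm_le_of_dotProduct_mulVec_le {m n : ℕ} {Z : Matrix (Fin m) (Fin n) ℝ} {c : ℝ}
    (hc : 0 ≤ c) (h : ∀ x y, x ⬝ᵥ Z *ᵥ y ≤ c * (vecNorm x * vecNorm y)) : ‖Z‖ ≤ c := by
  refine norm_le_of_vecNorm_le hc fun y => ?_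
  have h1 := h (Z *ᵥ y) y
  rw [← vecNorm_sq] at h1
  rcases (vecNorm_nonneg (Z *ᵥ y)).eq_or_lt with h0 | h0
  · rw [← h0]
    exact mul_nonneg hc (vecNorm_nonneg _)
  · exact le_of_mul_le_mul_left (by linarith) h0

lemma RIPn.norm_sub_le (h : RIPn calA K δ) (hadj : IsAdjointPair' calA calAstar) (hδ : 0 ≤ δ)
    {k : ℕ} (hk : k + 1 ≤ K) (B : Matrix (Fin n) (Fin k) ℝ) (C : Matrix (Fin k) (Fin n) ℝ) :
    ‖calAstar (calA (B * C)) - B * C‖ ≤ δ * frobNorm (B * C) := by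
  refine norm_le_of_dotProduct_mulVec_le (mul_nonneg hδ (frobNorm_nonneg _)) fun x y => ?_
  rw [sub_mulVec, dotProduct_sub, dotProduct_mulVec_eq_sum (calAstar _), ← hadj]
  exact h.inner_sub_le hδ hk B C x y

lemma mul_transpose_self_eq_sum {m n : ℕ} (C : Matrix (Fin m) (Fin n) ℝ) :
    C * Cᵀ = ∑ j, vecMulVec (C.col j) (C.col j) := by
  ext i j
  simp [mul_apply, Matrix.sum_apply, vecMulVec_apply, Matrix.col]

lemma RIPn.norm_mul_transpose_sub_le (h : RIPn calA K δ) (hadj : IsAdjointPair' calA calAstar)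
    (hδ : 0 ≤ δ) (hK : 2 ≤ K) {r : ℕ} (C : Matrix (Fin n) (Fin r) ℝ) :
    ‖calAstar (calA (C * Cᵀ)) - C * Cᵀ‖ ≤ δ * ((min r n : ℕ) * ‖C‖ ^ 2) := by
  refine le_trans ?_ (mul_le_mul_of_nonneg_left (frobNorm_sq_le_min C) hδ)
  rw [mul_transpose_self_eq_sum, map_sum, map_sum, ← Finset.sum_sub_distrib,
    frobNorm_sq_eq_sum_cols, Finset.mul_sum]
  refine norm_sum_le_of_le _ fun j _ => ?_
  have h1 := h.norm_sub_le hadj hδ (k := 1) (by omega)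
    (replicateCol (Fin 1) (C.col j)) (replicateRow (Fin 1) (C.col j))
  rw [replicateCol_mul_replicateRow, frobNorm_vecMulVec, ← sq] at h1
  exact h1

end RIP

/-! ### One step of the preconditioned recursion -/

lemma vecNorm_add_sq {n : ℕ} (v w : Fin n → ℝ) :
    vecNorm (v + w) ^ 2 = vecNorm v ^ 2 + 2 * (v ⬝ᵥ w) + vecNorm w ^ 2 := by
  simp only [vecNorm_sq, add_dotProduct, dotProduct_add]
  rw [dotProduct_comm w v]
  ring

lemma vecNorm_sub_smul_sq {n : ℕ} (v w : Fin n → ℝ) (a : ℝ) :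
    vecNorm (v - a • w) ^ 2 = vecNorm v ^ 2 - 2 * a * (v ⬝ᵥ w) + a ^ 2 * vecNorm w ^ 2 := by
  simp only [vecNorm_sq, sub_dotProduct, dotProduct_sub, smul_dotProduct, dotProduct_smul,
    smul_eq_mul]
  rw [dotProduct_comm w v]
  ring

lemma transpose_mulVec_dotProduct {m n : ℕ} (S : Matrix (Fin m) (Fin n) ℝ) (x y : Fin m → ℝ) :
    Sᵀ *ᵥ x ⬝ᵥ Sᵀ *ᵥ y = (S * Sᵀ) *ᵥ x ⬝ᵥ y := by
  rw [dotProduct_mulVec_transpose, transpose_transpose, mulVec_mulVec]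

lemma le_vecNorm_add_smul_mulVec {a : ℕ} {G : Matrix (Fin a) (Fin a) ℝ} {μ σ : ℝ} (hμ : 0 ≤ μ)
    (hG : ∀ x, σ ^ 2 * vecNorm x ^ 2 ≤ x ⬝ᵥ G *ᵥ x) (w : Fin a → ℝ) :
    (1 + μ * σ ^ 2) * vecNorm w ≤ vecNorm (w + μ • G *ᵥ w) := by
  rcases (vecNorm_nonneg w).eq_or_lt with h0 | h0
  · rw [← h0, mul_zero]
    exact vecNorm_nonneg _
  refine le_of_mul_le_mul_left ?_ h0
  have h1 := dotProduct_le_vecNorm w (w + μ • G *ᵥ w)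
  rw [dotProduct_add, dotProduct_smul, ← vecNorm_sq, smul_eq_mul] at h1
  have h2 := mul_le_mul_of_nonneg_left (hG w) hμ
  nlinarith

lemma vecNorm_mul_transpose_sub_sq_le {a r : ℕ} {S : Matrix (Fin a) (Fin r) ℝ} {s b : ℝ}
    (hs : 0 ≤ s) (hS : ∀ x, s * vecNorm x ≤ vecNorm (Sᵀ *ᵥ x)) (hb : 0 < b) (hSb : ‖S‖ ^ 2 ≤ b)
    (y : Fin a → ℝ) :
    vecNorm ((S * Sᵀ) *ᵥ y - s ^ 2 • y) ^ 2 ≤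
      b * (vecNorm (Sᵀ *ᵥ y) ^ 2 - s ^ 2 * vecNorm y ^ 2) := by
  set l := (S * Sᵀ) *ᵥ y - s ^ 2 • y with hl
  have h1 := pow_le_pow_left₀ (mul_nonneg hs (vecNorm_nonneg _)) (hS (y - b⁻¹ • l)) 2
  rw [mulVec_sub, mulVec_smul, mul_pow, vecNorm_sub_smul_sq y l,
    vecNorm_sub_smul_sq (Sᵀ *ᵥ y), transpose_mulVec_dotProduct] at h1
  have h2 : (S * Sᵀ) *ᵥ y ⬝ᵥ l - s ^ 2 * (y ⬝ᵥ l) = vecNorm l ^ 2 := by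
    rw [vecNorm_sq]
    conv_rhs => rw [hl]
    rw [sub_dotProduct, smul_dotProduct, smul_eq_mul]
  have h3 : vecNorm (Sᵀ *ᵥ l) ^ 2 ≤ b * vecNorm l ^ 2 := by
    have := pow_le_pow_left₀ (vecNorm_nonneg _) (vecNorm_mulVec_le Sᵀ l) 2
    rw [norm_transpose_eq, mul_pow] at this
    exact this.trans (by gcongr)
  have h4 : 0 ≤ s ^ 2 * vecNorm l ^ 2 := by positivity
  set e := vecNorm (Sᵀ *ᵥ y) ^ 2 - s ^ 2 * vecNorm y ^ 2 with he
  have h5 : 0 ≤ e - 2 * b⁻¹ * vecNorm l ^ 2 + b⁻¹ ^ 2 * (b * vecNorm l ^ 2) := by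
    have h6 : 0 ≤ b⁻¹ ^ 2 * (b * vecNorm l ^ 2 - vecNorm (Sᵀ *ᵥ l) ^ 2 + s ^ 2 * vecNorm l ^ 2) :=
      mul_nonneg (by positivity) (by linarith)
    rw [← h2]
    rw [← h2] at h6 h1
    nlinarith
  have h7 : e - 2 * b⁻¹ * vecNorm l ^ 2 + b⁻¹ ^ 2 * (b * vecNorm l ^ 2)
      = b⁻¹ * (b * e - vecNorm l ^ 2) := by
    field_simp
    ring
  rw [h7] at h5
  have := nonneg_of_mul_nonneg_right h5 (by positivity : 0 < b⁻¹)
  linarith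

lemma le_vecNorm_transpose_mulVec_sub_sq {a r : ℕ} {S : Matrix (Fin a) (Fin r) ℝ} {s b μ : ℝ}
    (hs : 0 ≤ s) (hS : ∀ x, s * vecNorm x ≤ vecNorm (Sᵀ *ᵥ x)) (hb : 0 < b) (hSb : ‖S‖ ^ 2 ≤ b)
    (hμ : 0 ≤ μ) (hsb : s ^ 2 ≤ b) (hμb : 6 * (μ * b) ≤ 1) (y : Fin a → ℝ) :
    s ^ 2 * (1 - 2 * μ * s ^ 2) * vecNorm y ^ 2 ≤
      vecNorm (Sᵀ *ᵥ (y - μ • (S * Sᵀ) *ᵥ y)) ^ 2 := by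
  have h1 := vecNorm_mul_transpose_sub_sq_le hs hS hb hSb y
  have he : 0 ≤ vecNorm (Sᵀ *ᵥ y) ^ 2 - s ^ 2 * vecNorm y ^ 2 := by
    have := pow_le_pow_left₀ (mul_nonneg hs (vecNorm_nonneg _)) (hS y) 2
    rw [mul_pow] at this
    linarith
  have h2 : (S * Sᵀ) *ᵥ y ⬝ᵥ y = vecNorm (Sᵀ *ᵥ y) ^ 2 := by
    rw [vecNorm_sq, transpose_mulVec_dotProduct]
  rw [vecNorm_sub_smul_sq, h2] at h1
  rw [mulVec_sub, mulVec_smul, vecNorm_sub_smul_sq, transpose_mulVec_dotProduct, ← vecNorm_sq]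
  set e := vecNorm (Sᵀ *ᵥ y) ^ 2 - s ^ 2 * vecNorm y ^ 2 with hedef
  set k := vecNorm ((S * Sᵀ) *ᵥ y) ^ 2
  have h3 : vecNorm (Sᵀ *ᵥ y) ^ 2 = e + s ^ 2 * vecNorm y ^ 2 := by rw [hedef]; ring
  rw [h3] at h1 ⊢
  have h4 : 0 ≤ μ ^ 2 * vecNorm (Sᵀ *ᵥ (S * Sᵀ) *ᵥ y) ^ 2 := by positivity
  have h5 : μ * k ≤ μ * (b * e + 2 * s ^ 2 * (e + s ^ 2 * vecNorm y ^ 2)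
      - (s ^ 2) ^ 2 * vecNorm y ^ 2) := mul_le_mul_of_nonneg_left (by linarith) hμ
  have h6 : μ * s ^ 2 * e ≤ μ * b * e := by gcongr
  have h7 : 6 * (μ * b) * e ≤ 1 * e := by gcongr
  nlinarith

/-- Size constraints on the scalars of one gradient step: `σ` and `u` are the extreme singular
values of the ground truth, `τ` bounds the tangent of the angle to the signal space. -/
structure StepScalars (μ σ u τ : ℝ) : Prop where
  μ_pos : 0 < μ
  σ_pos : 0 < σ
  σ_le : σ ≤ u
  τ_nonneg : 0 ≤ τ
  τ_le : τ ≤ 2 / 10 ^ 4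
  μ_u2 : μ * u ^ 2 ≤ 1 / 10 ^ 5
  μ_u4 : μ * u ^ 4 ≤ 1 / 10 ^ 5 * σ ^ 2
  u2_τ : u ^ 2 * τ ≤ 2 / 10 ^ 4 * σ ^ 2

section Step

variable {a q r : ℕ} {μ σ u τ : ℝ}

lemma StepScalars.vecNorm_le (hsc : StepScalars μ σ u τ) {K : Matrix (Fin a) (Fin a) ℝ}
    (hK : ‖K‖ ≤ 9 * u ^ 2) (v : Fin a → ℝ) : vecNorm v ≤ 2 * vecNorm (v - μ • K *ᵥ v) := by
  have h1 := vecNorm_sub_le_add v (-(μ • K *ᵥ v))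
  rw [← sub_eq_add_neg, ← neg_smul, vecNorm_smul, abs_neg, abs_of_pos hsc.μ_pos] at h1
  have h2 := mul_le_mul_of_nonneg_left (vecNorm_mulVec_le_of_le hK v) hsc.μ_pos.le
  have h3 := mul_le_mul_of_nonneg_right hsc.μ_u2 (vecNorm_nonneg v)
  nlinarith [vecNorm_nonneg v]

lemma StepScalars.le_vecNorm_mulVec (hsc : StepScalars μ σ u τ)
    {K G P : Matrix (Fin a) (Fin a) ℝ} (hK : ‖K‖ ≤ 9 * u ^ 2) (hG : ‖G‖ ≤ u ^ 2)
    (hGσ : ∀ x, σ ^ 2 * vecNorm x ^ 2 ≤ x ⬝ᵥ G *ᵥ x) (hP : ‖P‖ ≤ 1 / 100 * σ ^ 2)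
    (v : Fin a → ℝ) :
    (1 + 9 / 10 * (μ * σ ^ 2)) * vecNorm (v - μ • K *ᵥ v) ≤
      vecNorm ((1 + μ • (G - K + P)) *ᵥ v) := by
  have hμ := hsc.μ_pos
  have hv := hsc.vecNorm_le hK v
  set w := v - μ • K *ᵥ v with hw
  have h1 : (1 + μ • (G - K + P)) *ᵥ v =
      (w + μ • G *ᵥ w) + μ • (μ • G *ᵥ K *ᵥ v + P *ᵥ v) := by
    rw [hw]
    simp only [add_mulVec, sub_mulVec, smul_mulVec, one_mulVec, mulVec_sub, mulVec_smul, smul_sub,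
      smul_add]
    abel
  have h2 := vecNorm_sub_le_add (w + μ • G *ᵥ w) (μ • (μ • G *ᵥ K *ᵥ v + P *ᵥ v))
  have h3 := le_vecNorm_add_smul_mulVec hμ.le hGσ w
  have h4 : vecNorm (μ • G *ᵥ K *ᵥ v + P *ᵥ v) ≤ 1 / 20 * σ ^ 2 * vecNorm v := by
    refine (vecNorm_add_le _ _).trans ?_
    rw [vecNorm_smul, abs_of_pos hμ]
    have h5 : vecNorm (G *ᵥ K *ᵥ v) ≤ u ^ 2 * (9 * u ^ 2 * vecNorm v) :=
      (vecNorm_mulVec_le_of_le hG _).trans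
        (mul_le_mul_of_nonneg_left (vecNorm_mulVec_le_of_le hK _) (sq_nonneg u))
    have h6 := vecNorm_mulVec_le_of_le hP v
    have h7 := mul_le_mul_of_nonneg_right hsc.μ_u4 (vecNorm_nonneg v)
    have h8 := mul_le_mul_of_nonneg_left h5 hμ.le
    have h9 : 0 ≤ σ ^ 2 * vecNorm v := mul_nonneg (sq_nonneg σ) (vecNorm_nonneg v)
    nlinarith
  rw [h1]
  rw [vecNorm_smul, abs_of_pos hμ] at h2
  have h5 := mul_le_mul_of_nonneg_left h4 hμ.le
  have h6 : 0 ≤ μ * σ ^ 2 := by positivity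
  have h7 := mul_le_mul_of_nonneg_left hv h6
  nlinarith

lemma StepScalars.exists_eq_sub (hsc : StepScalars μ σ u τ)
    {K G P : Matrix (Fin a) (Fin a) ℝ} (hK : ‖K‖ ≤ 9 * u ^ 2) (hG : ‖G‖ ≤ u ^ 2)
    (hGσ : ∀ x, σ ^ 2 * vecNorm x ^ 2 ≤ x ⬝ᵥ G *ᵥ x) (hP : ‖P‖ ≤ 1 / 100 * σ ^ 2)
    (x : Fin a → ℝ) :
    ∃ y, (1 + μ • (G - K + P)) *ᵥ x = y - μ • K *ᵥ y ∧
      (1 + 9 / 10 * (μ * σ ^ 2)) * vecNorm x ≤ vecNorm y := by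
  have hμ := hsc.μ_pos
  obtain ⟨e, he⟩ := mulVec_surjective_of_le (A := 1 - μ • K) (c := 1 / 2) (by norm_num)
    (fun v => by
      rw [sub_mulVec, one_mulVec, smul_mulVec]
      linarith [hsc.vecNorm_le hK v]) (μ • (G *ᵥ x + P *ᵥ x))
  rw [sub_mulVec, one_mulVec, smul_mulVec] at he
  have hx := vecNorm_nonneg x
  have hσu : σ ^ 2 ≤ u ^ 2 := pow_le_pow_left₀ hsc.σ_pos.le hsc.σ_le 2
  have hPx := vecNorm_mulVec_le_of_le hP x
  have h1 : vecNorm e ≤ 4 * (μ * u ^ 2) * vecNorm x := by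
    have h2 := hsc.vecNorm_le hK e
    rw [he, vecNorm_smul, abs_of_pos hμ] at h2
    have h3 := vecNorm_add_le (G *ᵥ x) (P *ᵥ x)
    have h4 := vecNorm_mulVec_le_of_le hG x
    have h6 : σ ^ 2 * vecNorm x ≤ u ^ 2 * vecNorm x := by gcongr
    have h7 : vecNorm (G *ᵥ x + P *ᵥ x) ≤ 2 * (u ^ 2 * vecNorm x) := by nlinarith
    have := mul_le_mul_of_nonneg_left h7 hμ.le
    nlinarith
  refine ⟨x + e, ?_, ?_⟩
  · rw [mulVec_add, smul_add μ (K *ᵥ x), add_sub_add_comm, he]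
    simp only [add_mulVec, sub_mulVec, smul_mulVec, one_mulVec, smul_sub, smul_add]
    abel
  · have h2 : x + e = (x + μ • G *ᵥ x) + μ • (P *ᵥ x + K *ᵥ e) := by
      rw [sub_eq_iff_eq_add] at he
      conv_lhs => rw [he]
      simp only [smul_add]
      abel
    have h3 := vecNorm_sub_le_add (x + μ • G *ᵥ x) (μ • (P *ᵥ x + K *ᵥ e))
    have h4 := le_vecNorm_add_smul_mulVec hμ.le hGσ x
    rw [← h2, vecNorm_smul, abs_of_pos hμ] at h3
    have h5 : vecNorm (P *ᵥ x + K *ᵥ e) ≤ 1 / 20 * σ ^ 2 * vecNorm x := by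
      refine (vecNorm_add_le _ _).trans ?_
      have h6 := vecNorm_mulVec_le_of_le hK e
      have h7 := mul_le_mul_of_nonneg_left h1 (by positivity : 0 ≤ 9 * u ^ 2)
      have h8 := mul_le_mul_of_nonneg_right hsc.μ_u4 hx
      have h9 : 0 ≤ σ ^ 2 * vecNorm x := mul_nonneg (sq_nonneg σ) hx
      nlinarith
    have h6 := mul_le_mul_of_nonneg_left h5 hμ.le
    have h7 : 0 ≤ μ * σ ^ 2 * vecNorm x := by positivity
    nlinarith

/-- The signal part grows geometrically while it is small. -/
lemma StepScalars.growth (hsc : StepScalars μ σ u τ) {S : Matrix (Fin a) (Fin r) ℝ}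
    {R : Matrix (Fin q) (Fin r) ℝ} {G P : Matrix (Fin a) (Fin a) ℝ}
    {M : Matrix (Fin a) (Fin q) ℝ} {s : ℝ} (hs : 0 ≤ s) (hsσ : 10 * s ^ 2 ≤ σ ^ 2)
    (hS : ∀ x, s * vecNorm x ≤ vecNorm (Sᵀ *ᵥ x)) (hSu : ‖S‖ ≤ 3 * u)
    (hRS : R * Sᵀ = 0) (hGt : Gᵀ = G) (hG : ‖G‖ ≤ u ^ 2)
    (hGσ : ∀ x, σ ^ 2 * vecNorm x ^ 2 ≤ x ⬝ᵥ G *ᵥ x) (hP : ‖P‖ ≤ 1 / 100 * σ ^ 2)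
    (x : Fin a → ℝ) :
    s * (1 + 1 / 8 * μ * σ ^ 2) * vecNorm x ≤
      vecNorm (((1 + μ • (G - S * Sᵀ + P)) * S + μ • (M * R))ᵀ *ᵥ x) := by
  have hμ := hsc.μ_pos
  have hu : 0 < u := hsc.σ_pos.trans_le hsc.σ_le
  have hσu : σ ^ 2 ≤ u ^ 2 := pow_le_pow_left₀ hsc.σ_pos.le hsc.σ_le 2
  have hSu2 : ‖S‖ ^ 2 ≤ 9 * u ^ 2 := by
    have := pow_le_pow_left₀ (norm_nonneg _) hSu 2
    linarith
  have hK : ‖S * Sᵀ‖ ≤ 9 * u ^ 2 := by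
    have := l2_norm_mul_le_of_le hSu ((norm_transpose_eq S).trans_le hSu)
    linarith
  obtain ⟨y, hy, hxy⟩ := hsc.exists_eq_sub hK hG hGσ ((norm_transpose_eq P).trans_le hP) x
  have h1 := le_vecNorm_transpose_mulVec_sub_sq hs hS (b := 9 * u ^ 2) (by positivity) hSu2 hμ.le
    (by nlinarith) (by have := hsc.μ_u2; linarith) y
  have hQ : (1 + μ • (G - S * Sᵀ + P))ᵀ = 1 + μ • (G - S * Sᵀ + Pᵀ) := by
    simp only [transpose_add, transpose_sub, transpose_smul, transpose_one, transpose_mul,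
      transpose_transpose, hGt]
  have h2 : ((1 + μ • (G - S * Sᵀ + P)) * S + μ • (M * R))ᵀ *ᵥ x =
      Sᵀ *ᵥ (y - μ • (S * Sᵀ) *ᵥ y) + Rᵀ *ᵥ (μ • Mᵀ *ᵥ x) := by
    rw [transpose_add, transpose_mul, hQ, add_mulVec, ← mulVec_mulVec, hy]
    simp only [transpose_smul, transpose_mul, smul_mulVec, mulVec_smul, mulVec_mulVec]
  have h3 : Sᵀ *ᵥ (y - μ • (S * Sᵀ) *ᵥ y) ⬝ᵥ Rᵀ *ᵥ (μ • Mᵀ *ᵥ x) = 0 := by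
    rw [dotProduct_mulVec_transpose, transpose_transpose, mulVec_mulVec, hRS, zero_mulVec,
      zero_dotProduct]
  have h4 : vecNorm (Sᵀ *ᵥ (y - μ • (S * Sᵀ) *ᵥ y)) ^ 2 ≤
      vecNorm (((1 + μ • (G - S * Sᵀ + P)) * S + μ • (M * R))ᵀ *ᵥ x) ^ 2 := by
    rw [h2, vecNorm_add_sq, h3]
    have := sq_nonneg (vecNorm (Rᵀ *ᵥ (μ • Mᵀ *ᵥ x)))
    linarith
  refine (sq_le_sq₀ (mul_nonneg (by positivity) (vecNorm_nonneg _)) (vecNorm_nonneg _)).1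
    (le_trans ?_ (h1.trans h4))
  have hx := vecNorm_nonneg x
  have h5 := pow_le_pow_left₀ (mul_nonneg (by positivity) hx) hxy 2
  set z := μ * σ ^ 2 with hz
  have hz0 : 0 < z := by have := hsc.σ_pos; positivity
  have hz1 : z ≤ 1 / 10 ^ 5 := le_trans (by rw [hz]; gcongr) hsc.μ_u2
  have h6 : 2 * μ * s ^ 2 ≤ 1 / 5 * z := by
    have := mul_le_mul_of_nonneg_left hsσ hμ.le
    rw [hz]; linarith
  calc (s * (1 + 1 / 8 * μ * σ ^ 2) * vecNorm x) ^ 2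
      = s ^ 2 * vecNorm x ^ 2 * (1 + 1 / 8 * z) ^ 2 := by rw [hz]; ring
    _ ≤ s ^ 2 * vecNorm x ^ 2 * ((1 - 1 / 5 * z) * (1 + 9 / 10 * z) ^ 2) := by
        gcongr
        nlinarith [mul_pos hz0 hz0]
    _ = s ^ 2 * (1 - 1 / 5 * z) * ((1 + 9 / 10 * z) * vecNorm x) ^ 2 := by ring
    _ ≤ s ^ 2 * (1 - 2 * μ * s ^ 2) * vecNorm y ^ 2 := by
        have : 0 ≤ 1 - 2 * μ * s ^ 2 := by linarith
        gcongr

/-- The angle contracts under the linear part of the step. -/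
lemma StepScalars.exists_mul_eq (hsc : StepScalars μ σ u τ)
    {K G P : Matrix (Fin a) (Fin a) ℝ} {T B : Matrix (Fin q) (Fin a) ℝ}
    (hK : ‖K‖ ≤ 9 * u ^ 2) (hG : ‖G‖ ≤ u ^ 2)
    (hGσ : ∀ x, σ ^ 2 * vecNorm x ^ 2 ≤ x ⬝ᵥ G *ᵥ x) (hP : ‖P‖ ≤ 1 / 100 * σ ^ 2)
    (hT : ‖T‖ ≤ τ) (hB : ‖B‖ ≤ 1 / 100 * σ ^ 2 * τ) :
    ∃ Y : Matrix (Fin q) (Fin a) ℝ, Y * (1 + μ • (G - K + P)) = T + μ • (B - T * K) ∧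
      ‖Y‖ ≤ (1 - 1 / 2 * (μ * σ ^ 2)) * τ := by
  have hμ := hsc.μ_pos
  have hτ := hsc.τ_nonneg
  set Q := 1 + μ • (G - K + P) with hQ
  have hz0 : 0 < μ * σ ^ 2 := by have := hsc.σ_pos; positivity
  have hz1 : μ * σ ^ 2 ≤ 1 / 10 ^ 5 := by
    refine le_trans ?_ hsc.μ_u2
    have := hsc.σ_pos
    have := hsc.σ_le
    gcongr
  have hQ1 : ∀ v, (1 + 9 / 10 * (μ * σ ^ 2)) * vecNorm (v - μ • K *ᵥ v) ≤ vecNorm (Q *ᵥ v) :=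
    hsc.le_vecNorm_mulVec hK hG hGσ hP
  have hQ2 : ∀ v, vecNorm v ≤ 2 * vecNorm (Q *ᵥ v) := by
    intro v
    have := hQ1 v
    have := hsc.vecNorm_le hK v
    nlinarith [vecNorm_nonneg (v - μ • K *ᵥ v)]
  have hsurj := mulVec_surjective_of_le (A := Q) (c := 1 / 2) (by norm_num)
    (fun v => by linarith [hQ2 v])
  have hunit : IsUnit Q := mulVec_surjective_iff_isUnit.1 hsurj
  have hYQ : (T + μ • (B - T * K)) * Q⁻¹ * Q = T + μ • (B - T * K) :=
    nonsing_inv_mul_cancel_right _ _ ((isUnit_iff_isUnit_det Q).1 hunit)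
  refine ⟨(T + μ • (B - T * K)) * Q⁻¹, hYQ,
    norm_le_of_vecNorm_le (mul_nonneg (by linarith) hτ) fun w => ?_⟩
  obtain ⟨v, rfl⟩ := hsurj w
  rw [mulVec_mulVec, hYQ]
  have h1 : (T + μ • (B - T * K)) *ᵥ v = T *ᵥ (v - μ • K *ᵥ v) + μ • B *ᵥ v := by
    simp only [add_mulVec, sub_mulVec, smul_mulVec, mulVec_sub, mulVec_smul, smul_sub,
      mulVec_mulVec]
    abel
  rw [h1]
  refine (vecNorm_add_le _ _).trans ?_
  rw [vecNorm_smul, abs_of_pos hμ]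
  have h2 := vecNorm_mulVec_le_of_le hT (v - μ • K *ᵥ v)
  have h3 := mul_le_mul_of_nonneg_left (vecNorm_mulVec_le_of_le hB v) hμ.le
  have h4 := hQ1 v
  have h5 := hQ2 v
  have hn := vecNorm_nonneg (Q *ᵥ v)
  set z := μ * σ ^ 2 with hz
  have h6 : vecNorm (v - μ • K *ᵥ v) ≤ (1 - 8 / 10 * z) * vecNorm (Q *ᵥ v) := by
    have h7 : 1 ≤ (1 - 8 / 10 * z) * (1 + 9 / 10 * z) := by nlinarith
    calc vecNorm (v - μ • K *ᵥ v) ≤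
        (1 - 8 / 10 * z) * (1 + 9 / 10 * z) * vecNorm (v - μ • K *ᵥ v) :=
          le_mul_of_one_le_left (vecNorm_nonneg _) h7
      _ = (1 - 8 / 10 * z) * ((1 + 9 / 10 * z) * vecNorm (v - μ • K *ᵥ v)) := by ring
      _ ≤ _ := mul_le_mul_of_nonneg_left h4 (by linarith)
  have h7 := mul_le_mul_of_nonneg_left h6 hτ
  have h8 := mul_le_mul_of_nonneg_left h5 (mul_nonneg hz0.le hτ)
  have h9 : 0 ≤ z * τ * vecNorm (Q *ᵥ v) := by positivity
  have h10 : μ * (1 / 100 * σ ^ 2 * τ * vecNorm v) = 1 / 100 * (z * τ * vecNorm v) := by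
    rw [hz]; ring
  nlinarith

lemma norm_le_norm_add_mul {R : Matrix (Fin q) (Fin r) ℝ} {S : Matrix (Fin a) (Fin r) ℝ}
    (hRS : R * Sᵀ = 0) (A : Matrix (Fin q) (Fin a) ℝ) : ‖R‖ ≤ ‖R + A * S‖ := by
  rw [← norm_transpose_eq R, ← norm_transpose_eq (R + A * S)]
  refine norm_le_of_vecNorm_le (norm_nonneg _) fun x => le_trans ?_ (vecNorm_mulVec_le _ x)
  refine (sq_le_sq₀ (vecNorm_nonneg _) (vecNorm_nonneg _)).1 ?_
  rw [transpose_add, add_mulVec, vecNorm_add_sq, transpose_mul, ← mulVec_mulVec,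
    dotProduct_mulVec_transpose, transpose_transpose]
  have h : S *ᵥ Rᵀ *ᵥ x = 0 := by
    rw [mulVec_mulVec, ← transpose_transpose S, ← transpose_mul, hRS]
    simp
  rw [h, zero_dotProduct]
  nlinarith [sq_nonneg (vecNorm (Sᵀ *ᵥ Aᵀ *ᵥ x))]

lemma le_vecNorm_mul_transpose_mulVec {S : Matrix (Fin a) (Fin r) ℝ} {s : ℝ} (hs : 0 ≤ s)
    (hS : ∀ x, s * vecNorm x ≤ vecNorm (Sᵀ *ᵥ x)) (x : Fin a → ℝ) :
    s ^ 2 * vecNorm x ≤ vecNorm ((S * Sᵀ) *ᵥ x) := by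
  rcases (vecNorm_nonneg x).eq_or_lt with h0 | h0
  · rw [← h0, mul_zero]
    exact vecNorm_nonneg _
  refine le_of_mul_le_mul_right ?_ h0
  have h1 := pow_le_pow_left₀ (mul_nonneg hs h0.le) (hS x) 2
  have h2 := dotProduct_le_vecNorm ((S * Sᵀ) *ᵥ x) x
  rw [vecNorm_sq (Sᵀ *ᵥ x), transpose_mulVec_dotProduct] at h1
  nlinarith

lemma mul_norm_le_of_mul_eq {A C : Matrix (Fin q) (Fin a) ℝ} {K : Matrix (Fin a) (Fin a) ℝ}
    {s : ℝ} (hs : 0 < s) (hK : ∀ x, s * vecNorm x ≤ vecNorm (K *ᵥ x)) (h : A * K = C) :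
    s * ‖A‖ ≤ ‖C‖ := by
  rw [← le_div_iff₀' hs]
  refine norm_le_of_vecNorm_le (by positivity) fun w => ?_
  obtain ⟨x, rfl⟩ := mulVec_surjective_of_le hs hK w
  rw [mulVec_mulVec, h, div_mul_eq_mul_div, le_div_iff₀ hs]
  have h1 := vecNorm_mulVec_le C x
  have h2 := mul_le_mul_of_nonneg_left (hK x) (norm_nonneg C)
  nlinarith

lemma norm_one_le : ‖(1 : Matrix (Fin a) (Fin a) ℝ)‖ ≤ 1 :=
  norm_le_one_of_transpose_mul_self (by simp)

set_option maxHeartbeats 1000000 in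
/-- One gradient step in the block coordinates `(S, N)` given by the signal space and its
complement, where `N = T * S + R` splits `N` into its regression on `S` and a residual. -/
theorem StepScalars.step (hsc : StepScalars μ σ u τ) {S S' : Matrix (Fin a) (Fin r) ℝ}
    {N N' R : Matrix (Fin q) (Fin r) ℝ} {T : Matrix (Fin q) (Fin a) ℝ}
    {G D₁₁ : Matrix (Fin a) (Fin a) ℝ} {D₁₂ : Matrix (Fin a) (Fin q) ℝ}
    {D₂₁ : Matrix (Fin q) (Fin a) ℝ} {D₂₂ : Matrix (Fin q) (Fin q) ℝ} {s ρ d : ℝ}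
    (hs : 0 < s) (hsσ : 10 * s ^ 2 ≤ σ ^ 2) (hρs : ρ ≤ 4 * s) (hρ : ρ ^ 2 ≤ 1 / 10 ^ 5 * σ ^ 2)
    (hd : d ≤ 1 / 10 ^ 5 * (σ ^ 2 * τ))
    (hS : ∀ x, s * vecNorm x ≤ vecNorm (Sᵀ *ᵥ x)) (hSu : ‖S‖ ≤ 3 * u)
    (hN : N = T * S + R) (hRS : R * Sᵀ = 0) (hT : ‖T‖ ≤ τ) (hR : ‖R‖ ≤ ρ)
    (hGt : Gᵀ = G) (hG : ‖G‖ ≤ u ^ 2) (hGσ : ∀ x, σ ^ 2 * vecNorm x ^ 2 ≤ x ⬝ᵥ G *ᵥ x)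
    (h₁₁ : ‖D₁₁‖ ≤ d) (h₁₂ : ‖D₁₂‖ ≤ d) (h₂₁ : ‖D₂₁‖ ≤ d) (h₂₂ : ‖D₂₂‖ ≤ d)
    (hS' : S' = S + μ • ((G - S * Sᵀ + D₁₁) * S + (D₁₂ - S * Nᵀ) * N))
    (hN' : N' = N + μ • ((D₂₁ - N * Sᵀ) * S + (D₂₂ - N * Nᵀ) * N)) :
    (∀ x, s * (1 + 1 / 8 * μ * σ ^ 2) * vecNorm x ≤ vecNorm (S'ᵀ *ᵥ x)) ∧
      ∃ (T' : Matrix (Fin q) (Fin a) ℝ) (R' : Matrix (Fin q) (Fin r) ℝ),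
        N' = T' * S' + R' ∧ R' * S'ᵀ = 0 ∧ ‖T'‖ ≤ τ ∧
          ‖R'‖ ≤ ρ * (1 + 80 * μ * (1 / 10 ^ 4) * σ ^ 2) := by
  have hμ := hsc.μ_pos
  have hσ := hsc.σ_pos
  have hτ := hsc.τ_nonneg
  have hτ1 := hsc.τ_le
  have hu : 0 < u := hσ.trans_le hsc.σ_le
  have hσ2 : 0 < σ ^ 2 := by positivity
  have hσu : σ ^ 2 ≤ u ^ 2 := pow_le_pow_left₀ hσ.le hsc.σ_le 2
  have hρ0 : 0 ≤ ρ := (norm_nonneg R).trans hR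
  have hστ : σ ^ 2 * τ ≤ 2 / 10 ^ 4 * σ ^ 2 := by nlinarith [sq_nonneg σ]
  have hSRt : S * Rᵀ = 0 := by
    have := congrArg Matrix.transpose hRS
    simpa using this
  set K := S * Sᵀ with hKdef
  have hKt : Kᵀ = K := by rw [hKdef, transpose_mul, transpose_transpose]
  have hNt : Nᵀ = Sᵀ * Tᵀ + Rᵀ := by rw [hN, transpose_add, transpose_mul]
  have hSN : S * Nᵀ = K * Tᵀ := by rw [hNt, Matrix.mul_add, hSRt, add_zero, Matrix.mul_assoc]
  have hNS : N * Sᵀ = T * K := by rw [hN, Matrix.add_mul, hRS, add_zero, Matrix.mul_assoc]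
  have hNN : N * Nᵀ = T * K * Tᵀ + R * Rᵀ := by
    rw [hNt, Matrix.mul_add, ← Matrix.mul_assoc, hNS]
    congr 1
    rw [hN, Matrix.add_mul, Matrix.mul_assoc, hSRt, Matrix.mul_zero, zero_add]
  rw [hSN] at hS'
  rw [hNS, hNN] at hN'
  have hK : ‖K‖ ≤ 9 * u ^ 2 := by
    have := l2_norm_mul_le_of_le hSu ((norm_transpose_eq S).trans_le hSu)
    linarith
  set M := D₁₂ - K * Tᵀ with hMdef
  have hM : ‖M‖ ≤ 19 / 10 ^ 4 * σ ^ 2 := by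
    have := norm_sub_le_add h₁₂ (l2_norm_mul_le_of_le hK ((norm_transpose_eq T).trans_le hT))
    have := hsc.u2_τ
    linarith
  set M₂ := D₂₂ - (T * K * Tᵀ + R * Rᵀ) with hM₂def
  have hM₂ : ‖M₂‖ ≤ 2 / 10 ^ 5 * σ ^ 2 := by
    have h1 := norm_sub_le_add h₂₂ (norm_add_le_add
      (l2_norm_mul_le_of_le (l2_norm_mul_le_of_le hT hK) ((norm_transpose_eq T).trans_le hT))
      (l2_norm_mul_le_of_le hR ((norm_transpose_eq R).trans_le hR)))
    have h2 := mul_le_mul_of_nonneg_left hsc.u2_τ hτ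
    nlinarith
  set P := D₁₁ + M * T with hPdef
  have hP : ‖P‖ ≤ 1 / 100 * σ ^ 2 := by
    have := norm_add_le_add h₁₁ (l2_norm_mul_le_of_le hM hT)
    linarith
  set B := M₂ * T + D₂₁ with hBdef
  have hB : ‖B‖ ≤ 1 / 100 * σ ^ 2 * τ := by
    have := norm_add_le_add (l2_norm_mul_le_of_le hM₂ hT) h₂₁
    have : 0 ≤ σ ^ 2 * τ := by positivity
    linarith
  set Q := 1 + μ • (G - K + P) with hQdef
  have hS'Q : S' = Q * S + μ • (M * R) := by
    rw [hS', hN, hQdef, hPdef]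
    simp only [Matrix.add_mul, Matrix.mul_add, Matrix.smul_mul, Matrix.one_mul,
      Matrix.mul_assoc, smul_add]
    abel
  have hgrow : ∀ x, s * (1 + 1 / 8 * μ * σ ^ 2) * vecNorm x ≤ vecNorm (S'ᵀ *ᵥ x) := by
    rw [hS'Q]
    exact hsc.growth hs.le hsσ hS hSu hRS hGt hG hGσ hP
  refine ⟨hgrow, ?_⟩
  obtain ⟨Y, hYQ, hY⟩ := hsc.exists_mul_eq hK hG hGσ hP hT hB
  rw [← hQdef] at hYQ
  have hz0 : 0 < μ * σ ^ 2 := by positivity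
  have hz1 : μ * σ ^ 2 ≤ 1 / 10 ^ 5 := le_trans (by gcongr) hsc.μ_u2
  have hYτ : ‖Y‖ ≤ τ := hY.trans (by nlinarith)
  set F := 1 + μ • (M₂ - Y * M) with hFdef
  have hF : ‖F‖ ≤ 1 + μ * (1 / 10 ^ 4 * σ ^ 2) := by
    refine norm_add_le_add norm_one_le (norm_smul_le_of_le hμ.le ?_)
    have := norm_sub_le_add hM₂ (l2_norm_mul_le_of_le hYτ hM)
    nlinarith
  have hN'Y : N' - Y * S' = F * R := by
    have h1 : N' = (Y * Q) * S + (1 + μ • M₂) * R := by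
      rw [hN', hN, hYQ, hBdef]
      simp only [Matrix.add_mul, Matrix.sub_mul, Matrix.mul_add, Matrix.smul_mul, Matrix.one_mul,
        Matrix.mul_assoc, smul_add, smul_sub]
      abel
    rw [h1, hS'Q, hFdef]
    simp only [Matrix.add_mul, Matrix.sub_mul, Matrix.mul_add, Matrix.smul_mul, Matrix.one_mul,
      Matrix.mul_assoc, Matrix.mul_smul, smul_sub]
    abel
  have hs' : ∀ x, s * vecNorm x ≤ vecNorm (S'ᵀ *ᵥ x) := fun x => by
    have := vecNorm_nonneg x
    refine le_trans ?_ (hgrow x)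
    have : 0 ≤ s * (1 / 8 * μ * σ ^ 2) * vecNorm x := by positivity
    linarith
  have hK' := le_vecNorm_mul_transpose_mulVec hs.le hs'
  set K' := S' * S'ᵀ with hK'def
  have hK'unit : IsUnit K'.det := (isUnit_iff_isUnit_det K').1
    (mulVec_surjective_iff_isUnit.1 (mulVec_surjective_of_le (by positivity) hK'))
  set T' := N' * S'ᵀ * K'⁻¹ with hT'def
  have hR'S' : (N' - T' * S') * S'ᵀ = 0 := by
    rw [Matrix.sub_mul, Matrix.mul_assoc T', ← hK'def, hT'def,
      nonsing_inv_mul_cancel_right _ _ hK'unit, sub_self]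
  have hFR : F * R = (N' - T' * S') + (T' - Y) * S' := by
    rw [← hN'Y, Matrix.sub_mul]
    abel
  have hFRn : ‖F * R‖ ≤ (1 + μ * (1 / 10 ^ 4 * σ ^ 2)) * ρ := l2_norm_mul_le_of_le hF hR
  refine ⟨T', N' - T' * S', by abel, hR'S', ?_, ?_⟩
  swap
  · refine (norm_le_norm_add_mul hR'S' (T' - Y)).trans ?_
    rw [← hFR]
    refine hFRn.trans ?_
    have : 0 ≤ μ * σ ^ 2 * ρ := by positivity
    linarith
  have hF2 : ‖F‖ ≤ 2 := hF.trans (by linarith)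
  have hdiff : ‖S' - S‖ ≤ μ * (34 * u ^ 3) := by
    have h1 : S' - S = μ • ((G - K + P) * S + M * R) := by
      rw [hS'Q, hQdef]
      simp only [Matrix.add_mul, Matrix.smul_mul, Matrix.one_mul, smul_add]
      abel
    rw [h1]
    refine norm_smul_le_of_le hμ.le ?_
    refine (norm_add_le_add (l2_norm_mul_le_of_le (norm_add_le_add (norm_sub_le_add hG hK) hP) hSu)
      (l2_norm_mul_le_of_le hM hR)).trans ?_
    have h2 : ρ ≤ u := (sq_le_sq₀ hρ0 hu.le).1 (by linarith)
    have h3 : σ ^ 2 * ρ ≤ u ^ 2 * u := by gcongr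
    have h4 : σ ^ 2 * u ≤ u ^ 2 * u := by gcongr
    have h5 := pow_pos hu 3
    linarith
  have hdiff1 : ‖S' - S‖ ≤ u := hdiff.trans (by
    have := mul_le_mul_of_nonneg_right hsc.μ_u2 hu.le
    linarith)
  have hS'u : ‖S'‖ ≤ 4 * u := by
    have := norm_add_le_add hdiff1 hSu
    rw [sub_add_cancel] at this
    linarith
  have hKK : ‖K' - K‖ ≤ 238 / 10 ^ 5 * σ ^ 2 := by
    have h1 : K' - K = (S' - S) * S'ᵀ + S * (S' - S)ᵀ := by
      rw [hK'def, hKdef, transpose_sub, Matrix.sub_mul, Matrix.mul_sub]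
      abel
    rw [h1]
    refine (norm_add_le_add (l2_norm_mul_le_of_le hdiff ((norm_transpose_eq S').trans_le hS'u))
      (l2_norm_mul_le_of_le hSu ((norm_transpose_eq _).trans_le hdiff))).trans ?_
    have := hsc.μ_u4
    linarith
  have hmain : (T' - Y + μ • (F * R * Rᵀ * T)) * K' =
      μ • (F * R * Rᵀ * (T * (K' - K) + D₁₂ᵀ)) := by
    have h1 : (T' - Y) * K' = μ • (F * R * Rᵀ * Mᵀ) := by
      have h2 : F * R * S'ᵀ = (T' - Y) * K' := by
        rw [hFR, Matrix.add_mul, hR'S', zero_add, Matrix.mul_assoc]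
      rw [← h2, hS'Q, transpose_add, transpose_mul, transpose_smul, transpose_mul, Matrix.mul_add,
        Matrix.mul_assoc F, ← Matrix.mul_assoc R, hRS, Matrix.zero_mul, Matrix.mul_zero, zero_add,
        Matrix.mul_smul, ← Matrix.mul_assoc]
    rw [Matrix.add_mul, h1, hMdef, transpose_sub, transpose_mul, transpose_transpose, hKt,
      Matrix.smul_mul, ← smul_add, Matrix.mul_assoc _ T K', ← Matrix.mul_add, Matrix.mul_sub]
    congr 2
    abel
  have hFRR : ‖F * R * Rᵀ‖ ≤ 2 * ρ * ρ :=
    l2_norm_mul_le_of_le (l2_norm_mul_le_of_le hF2 hR) ((norm_transpose_eq R).trans_le hR)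
  have hA : ‖T' - Y + μ • (F * R * Rᵀ * T)‖ ≤ 8 / 100 * (μ * σ ^ 2 * τ) := by
    have h1 := mul_norm_le_of_mul_eq (by positivity) hK' hmain
    have h2 := norm_smul_le_of_le hμ.le (l2_norm_mul_le_of_le hFRR
      (norm_add_le_add (l2_norm_mul_le_of_le hT hKK) ((norm_transpose_eq D₁₂).trans_le h₁₂)))
    have h3 : ρ * ρ ≤ 16 * s ^ 2 := by nlinarith
    have h4 : 0 ≤ μ * σ ^ 2 * τ := by positivity
    refine le_of_mul_le_mul_left ?_ (by positivity : 0 < s ^ 2)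
    refine (h1.trans h2).trans ?_
    calc μ * (2 * ρ * ρ * (τ * (238 / 10 ^ 5 * σ ^ 2) + d))
        ≤ μ * (2 * ρ * ρ * (τ * (238 / 10 ^ 5 * σ ^ 2) + 1 / 10 ^ 5 * (σ ^ 2 * τ))) := by gcongr
      _ = 478 / 10 ^ 5 * (μ * σ ^ 2 * τ) * (ρ * ρ) := by ring
      _ ≤ 478 / 10 ^ 5 * (μ * σ ^ 2 * τ) * (16 * s ^ 2) := by gcongr
      _ ≤ _ := by nlinarith [mul_nonneg h4 (sq_nonneg s)]
  have hFT : ‖μ • (F * R * Rᵀ * T)‖ ≤ μ * (2 * ρ * ρ * τ) :=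
    norm_smul_le_of_le hμ.le (l2_norm_mul_le_of_le hFRR hT)
  have hT' : T' = Y + (T' - Y + μ • (F * R * Rᵀ * T)) - μ • (F * R * Rᵀ * T) := by abel
  rw [hT']
  refine (norm_sub_le_add (norm_add_le_add hY hA) hFT).trans ?_
  have h1 : 0 ≤ μ * τ := by positivity
  have h2 := mul_le_mul_of_nonneg_left hρ h1
  nlinarith

end Step

/-! ### One gradient step in ambient coordinates -/

lemma norm_sub_smul_mul_transpose_le {n r : ℕ} {U : Matrix (Fin n) (Fin r) ℝ} {μ b : ℝ}
    (hμ : 0 ≤ μ) (hb : 0 ≤ b) (hμb : 2 * (μ * b ^ 2) ≤ 1) (hU : ‖U‖ ≤ b) :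
    ‖U - μ • ((U * Uᵀ) * U)‖ ≤ b * (1 - 1 / 2 * (μ * b ^ 2)) := by
  have h0 : 0 ≤ b * (1 - 1 / 2 * (μ * b ^ 2)) := mul_nonneg hb (by linarith)
  rw [← norm_transpose_eq]
  refine norm_le_of_vecNorm_le h0 fun y => ?_
  rcases (vecNorm_nonneg y).eq_or_lt with hy | hy
  · simp [vecNorm_eq_zero.1 hy.symm, vecNorm_zero]
  refine (sq_le_sq₀ (vecNorm_nonneg _) (mul_nonneg h0 hy.le)).1 ?_
  have h1 : (U - μ • ((U * Uᵀ) * U))ᵀ *ᵥ y = Uᵀ *ᵥ y - μ • Uᵀ *ᵥ (U * Uᵀ) *ᵥ y := by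
    rw [transpose_sub, transpose_smul, transpose_mul, transpose_mul, transpose_transpose,
      sub_mulVec, smul_mulVec, ← mulVec_mulVec]
  rw [h1, vecNorm_sub_smul_sq, transpose_mulVec_dotProduct, ← vecNorm_sq]
  have hUt : ‖Uᵀ‖ ≤ b := (norm_transpose_eq U).trans_le hU
  have h2 : vecNorm (Uᵀ *ᵥ (U * Uᵀ) *ᵥ y) ^ 2 ≤ b ^ 2 * vecNorm ((U * Uᵀ) *ᵥ y) ^ 2 := by
    rw [← mul_pow]
    exact pow_le_pow_left₀ (vecNorm_nonneg _) (vecNorm_mulVec_le_of_le hUt _) 2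
  have h3 : vecNorm (Uᵀ *ᵥ y) ^ 2 ≤ b ^ 2 * vecNorm y ^ 2 := by
    rw [← mul_pow]
    exact pow_le_pow_left₀ (vecNorm_nonneg _) (vecNorm_mulVec_le_of_le hUt _) 2
  have h4 : (vecNorm (Uᵀ *ᵥ y) ^ 2) ^ 2 ≤ vecNorm ((U * Uᵀ) *ᵥ y) ^ 2 * vecNorm y ^ 2 := by
    have : vecNorm (Uᵀ *ᵥ y) ^ 2 = (U * Uᵀ) *ᵥ y ⬝ᵥ y := by
      rw [vecNorm_sq, transpose_mulVec_dotProduct]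
    rw [← mul_pow]
    exact pow_le_pow_left₀ (sq_nonneg _) (this.trans_le (dotProduct_le_vecNorm _ _)) 2
  set p := vecNorm (Uᵀ *ᵥ y) ^ 2
  set q := vecNorm ((U * Uᵀ) *ᵥ y) ^ 2 with hq
  set Y := vecNorm y ^ 2 with hY
  have hq0 : 0 ≤ q := sq_nonneg _
  have hY0 : 0 < Y := by positivity
  have h5 : μ ^ 2 * vecNorm (Uᵀ *ᵥ (U * Uᵀ) *ᵥ y) ^ 2 ≤ μ * q := by
    have h6 := mul_le_mul_of_nonneg_left h2 (sq_nonneg μ)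
    have h7 : μ * (μ * b ^ 2) * q ≤ μ * 1 * q := by
      have : μ * b ^ 2 ≤ 1 := by nlinarith [mul_nonneg hμ (sq_nonneg b)]
      gcongr
    linarith
  have h8 : p - μ * q ≤ (b ^ 2 - μ * (b ^ 2) ^ 2) * Y := by
    refine le_of_mul_le_mul_right ?_ hY0
    have h9 := mul_le_mul_of_nonneg_left h4 hμ
    have h10 : 0 ≤ (b ^ 2 * Y - p) * (Y - μ * (b ^ 2 * Y + p)) := by
      refine mul_nonneg (by linarith) ?_
      have := mul_le_mul_of_nonneg_left h3 hμ
      have := mul_le_mul_of_nonneg_right hμb hY0.le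
      linarith
    linarith
  have h11 : (b ^ 2 - μ * (b ^ 2) ^ 2) * Y ≤ (b * (1 - 1 / 2 * (μ * b ^ 2)) * vecNorm y) ^ 2 := by
    have : (b * (1 - 1 / 2 * (μ * b ^ 2)) * vecNorm y) ^ 2 =
        (b ^ 2 - μ * (b ^ 2) ^ 2 + (1 / 2 * (b * (μ * b ^ 2))) ^ 2) * Y := by
      rw [hY]; ring
    rw [this]
    have := sq_nonneg (1 / 2 * (b * (μ * b ^ 2)))
    gcongr
    linarith
  linarith

lemma norm_add_smul_sub_mul_le {n r : ℕ} {U : Matrix (Fin n) (Fin r) ℝ}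
    {Z : Matrix (Fin n) (Fin n) ℝ} {μ u : ℝ} (hμ : 0 ≤ μ) (hu : 0 ≤ u) (hμu : μ * u ^ 2 ≤ 1 / 18)
    (hU : ‖U‖ ≤ 3 * u) (hZ : ‖Z‖ ≤ 2 * u ^ 2) :
    ‖U + μ • ((Z - U * Uᵀ) * U)‖ ≤ 3 * u := by
  have h1 : U + μ • ((Z - U * Uᵀ) * U) = U - μ • ((U * Uᵀ) * U) + μ • (Z * U) := by
    rw [Matrix.sub_mul, smul_sub]
    abel
  rw [h1]
  refine (norm_add_le_add (norm_sub_smul_mul_transpose_le hμ (by positivity) (by linarith) hU)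
    (norm_smul_le_of_le hμ (l2_norm_mul_le_of_le hZ hU))).trans ?_
  have : 0 ≤ μ * u ^ 3 := by positivity
  linarith

lemma RIPn.norm_residual_le {n m K k r : ℕ} {δ : ℝ}
    {calA : Matrix (Fin n) (Fin n) ℝ →ₗ[ℝ] (Fin m → ℝ)}
    {calAstar : (Fin m → ℝ) →ₗ[ℝ] Matrix (Fin n) (Fin n) ℝ}
    (h : RIPn calA K δ) (hadj : IsAdjointPair' calA calAstar) (hδ : 0 ≤ δ) (hK : 2 ≤ K)
    (hk : k + 1 ≤ K) (A L : Matrix (Fin n) (Fin k) ℝ) {U R : Matrix (Fin n) (Fin r) ℝ}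
    {S : Matrix (Fin k) (Fin r) ℝ} (hU : U = L * S + R) (hR : R * Sᵀ = 0) :
    ‖calAstar (calA (A * Aᵀ - U * Uᵀ)) - (A * Aᵀ - U * Uᵀ)‖ ≤
      δ * (Real.sqrt k * (‖A‖ * ‖A‖) + Real.sqrt k * (‖L‖ * (‖S‖ * ‖S‖ * ‖L‖)) +
        (min r n : ℕ) * ‖R‖ ^ 2) := by
  have hR' : S * Rᵀ = 0 := by simpa using congrArg Matrix.transpose hR
  have hZ : A * Aᵀ - U * Uᵀ = A * Aᵀ - L * (S * Sᵀ * Lᵀ) - R * Rᵀ := by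
    have : U * Uᵀ = L * (S * Sᵀ * Lᵀ) + R * Rᵀ := by
      rw [hU, transpose_add, transpose_mul, Matrix.add_mul, Matrix.mul_add, Matrix.mul_add,
        ← Matrix.mul_assoc R, hR, Matrix.zero_mul, zero_add, Matrix.mul_assoc L S Rᵀ, hR',
        Matrix.mul_zero, add_zero]
      simp only [Matrix.mul_assoc]
    rw [this]
    abel
  have h1 := h.norm_sub_le hadj hδ hk A Aᵀ
  have h2 := h.norm_sub_le hadj hδ hk L (S * Sᵀ * Lᵀ)
  have h3 := h.norm_mul_transpose_sub_le hadj hδ hK R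
  have h4 := frobNorm_mul_le A Aᵀ
  have h5 : frobNorm (L * (S * Sᵀ * Lᵀ)) ≤ Real.sqrt k * (‖L‖ * (‖S‖ * ‖S‖ * ‖L‖)) := by
    refine (frobNorm_mul_le _ _).trans ?_
    have := l2_norm_mul_le_of_le (l2_norm_mul_le_of_le le_rfl (norm_transpose_eq S).le)
      (norm_transpose_eq L).le (A := S * Sᵀ)
    gcongr
  rw [norm_transpose_eq] at h4
  rw [hZ, map_sub, map_sub, map_sub, map_sub]
  have h6 : calAstar (calA (A * Aᵀ)) - calAstar (calA (L * (S * Sᵀ * Lᵀ))) -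
      calAstar (calA (R * Rᵀ)) - (A * Aᵀ - L * (S * Sᵀ * Lᵀ) - R * Rᵀ) =
      (calAstar (calA (A * Aᵀ)) - A * Aᵀ) -
        (calAstar (calA (L * (S * Sᵀ * Lᵀ))) - L * (S * Sᵀ * Lᵀ)) -
        (calAstar (calA (R * Rᵀ)) - R * Rᵀ) := by abel
  rw [h6]
  refine (norm_sub_le_add (norm_sub_le_add h1 h2) h3).trans ?_
  have := mul_le_mul_of_nonneg_left h4 hδ
  have := mul_le_mul_of_nonneg_left h5 hδ
  linarith

/-- `V` and `Vp` are orthonormal bases of complementary orthogonal subspaces. -/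
structure IsOrthoSplit {n a q : ℕ} (V : Matrix (Fin n) (Fin a) ℝ) (Vp : Matrix (Fin n) (Fin q) ℝ) :
    Prop where
  left : Vᵀ * V = 1
  right : Vpᵀ * Vp = 1
  sum : V * Vᵀ + Vp * Vpᵀ = 1

namespace IsOrthoSplit

variable {n a q r : ℕ} {V : Matrix (Fin n) (Fin a) ℝ} {Vp : Matrix (Fin n) (Fin q) ℝ}

lemma left_right (h : IsOrthoSplit V Vp) : Vᵀ * Vp = 0 := by
  have h1 : Vᵀ * (V * Vᵀ + Vp * Vpᵀ) * Vp = Vᵀ * Vp := by rw [h.sum, Matrix.mul_one]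
  rw [Matrix.mul_add, ← Matrix.mul_assoc, h.left, Matrix.one_mul, Matrix.add_mul,
    ← Matrix.mul_assoc, Matrix.mul_assoc _ Vpᵀ Vp, h.right, Matrix.mul_one] at h1
  simpa using h1

lemma right_left (h : IsOrthoSplit V Vp) : Vpᵀ * V = 0 := by
  simpa using congrArg Matrix.transpose h.left_right

lemma eq_add (h : IsOrthoSplit V Vp) (U : Matrix (Fin n) (Fin r) ℝ) :
    U = V * (Vᵀ * U) + Vp * (Vpᵀ * U) := by
  rw [← Matrix.mul_assoc, ← Matrix.mul_assoc, ← Matrix.add_mul, h.sum, Matrix.one_mul]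

lemma vecNorm_sq_eq (h : IsOrthoSplit V Vp) (x : Fin n → ℝ) :
    vecNorm x ^ 2 = vecNorm (Vᵀ *ᵥ x) ^ 2 + vecNorm (Vpᵀ *ᵥ x) ^ 2 := by
  rw [vecNorm_mulVec_sq, vecNorm_mulVec_sq, ← dotProduct_add, ← add_mulVec, transpose_transpose,
    transpose_transpose, h.sum, one_mulVec, vecNorm_sq]

lemma norm_left_le (h : IsOrthoSplit V Vp) : ‖V‖ ≤ 1 := norm_le_one_of_transpose_mul_self h.left

lemma norm_right_le (h : IsOrthoSplit V Vp) : ‖Vp‖ ≤ 1 := norm_le_one_of_transpose_mul_self h.right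

end IsOrthoSplit

/-- Quantitative control of `U` with respect to the signal space spanned by `V` and its complement
spanned by `Vp`: the component along `V` is at least `s`, and the component along `Vp` is a small
multiple of it up to a residual of size `ρ`. -/
structure SignalSplit {n a q r : ℕ} (V : Matrix (Fin n) (Fin a) ℝ) (Vp : Matrix (Fin n) (Fin q) ℝ)
    (u τ s ρ : ℝ) (U : Matrix (Fin n) (Fin r) ℝ) : Prop where
  norm_le : ‖U‖ ≤ 3 * u
  le_vecNorm : ∀ x, s * vecNorm x ≤ vecNorm ((Vᵀ * U)ᵀ *ᵥ x)
  exists_split : ∃ (T : Matrix (Fin q) (Fin a) ℝ) (R : Matrix (Fin q) (Fin r) ℝ),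
    Vpᵀ * U = T * (Vᵀ * U) + R ∧ R * (Vᵀ * U)ᵀ = 0 ∧ ‖T‖ ≤ τ ∧ ‖R‖ ≤ ρ

lemma norm_sandwich_le {n k l : ℕ} {V : Matrix (Fin n) (Fin k) ℝ} {W : Matrix (Fin n) (Fin l) ℝ}
    {D : Matrix (Fin n) (Fin n) ℝ} {d : ℝ} (hV : ‖V‖ ≤ 1) (hW : ‖W‖ ≤ 1) (hD : ‖D‖ ≤ d) :
    ‖Vᵀ * D * W‖ ≤ d := by
  have := l2_norm_mul_le_of_le (l2_norm_mul_le_of_le ((norm_transpose_eq V).trans_le hV) hD) hW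
  linarith

theorem SignalSplit.step {n a q r : ℕ} {V : Matrix (Fin n) (Fin a) ℝ}
    {Vp : Matrix (Fin n) (Fin q) ℝ} {μ σ u τ s ρ d : ℝ} {U U' : Matrix (Fin n) (Fin r) ℝ}
    {A : Matrix (Fin n) (Fin a) ℝ} {D : Matrix (Fin n) (Fin n) ℝ}
    (hU : SignalSplit V Vp u τ s ρ U) (hV : IsOrthoSplit V Vp) (hsc : StepScalars μ σ u τ)
    (hs : 0 < s) (hsσ : 10 * s ^ 2 ≤ σ ^ 2) (hρs : ρ ≤ 4 * s) (hρ : ρ ^ 2 ≤ 1 / 10 ^ 5 * σ ^ 2)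
    (hd : d ≤ 1 / 10 ^ 5 * (σ ^ 2 * τ)) (hA : ‖A‖ ≤ u) (hVA : V * Vᵀ * A = A)
    (hσA : ∀ x, σ * vecNorm x ≤ vecNorm (A *ᵥ x)) (hD : ‖D‖ ≤ d)
    (hU' : U' = U + μ • ((A * Aᵀ + D - U * Uᵀ) * U)) :
    SignalSplit V Vp u τ (s * (1 + 1 / 8 * μ * σ ^ 2))
      (ρ * (1 + 80 * μ * (1 / 10 ^ 4) * σ ^ 2)) U' := by
  have hσ := hsc.σ_pos
  have hu : 0 < u := hσ.trans_le hsc.σ_le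
  have hVn := hV.norm_left_le
  have hVpn := hV.norm_right_le
  have hVpA : Vpᵀ * A = 0 := by
    rw [← hVA, ← Matrix.mul_assoc, ← Matrix.mul_assoc, hV.right_left, Matrix.zero_mul,
      Matrix.zero_mul]
  have hAVp : Aᵀ * Vp = 0 := by simpa using congrArg Matrix.transpose hVpA
  obtain ⟨T, R, hN, hRS, hT, hR⟩ := hU.exists_split
  have hblock : ∀ {k : ℕ} (C : Matrix (Fin n) (Fin k) ℝ), Cᵀ * U' = Cᵀ * U +
      μ • (((Cᵀ * A) * (Aᵀ * V) - (Cᵀ * U) * (Vᵀ * U)ᵀ + Cᵀ * D * V) * (Vᵀ * U) +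
        ((Cᵀ * A) * (Aᵀ * Vp) - (Cᵀ * U) * (Vpᵀ * U)ᵀ + Cᵀ * D * Vp) * (Vpᵀ * U)) := by
    intro k C
    rw [hU', Matrix.mul_add, Matrix.mul_smul]
    congr 2
    have : Cᵀ * ((A * Aᵀ + D - U * Uᵀ) * U) =
        Cᵀ * ((A * Aᵀ + D - U * Uᵀ) * (V * (Vᵀ * U) + Vp * (Vpᵀ * U))) := by
      rw [← hV.eq_add U]
    rw [this]
    simp only [Matrix.add_mul, Matrix.sub_mul, Matrix.mul_add, Matrix.mul_sub, Matrix.mul_assoc,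
      transpose_mul, transpose_transpose]
    abel
  have hAV : ∀ x, σ * vecNorm x ≤ vecNorm ((Aᵀ * V) *ᵥ x) := by
    have h1 : ∀ x, σ * vecNorm x ≤ vecNorm ((Vᵀ * A) *ᵥ x) := fun x => by
      refine (hσA x).trans_eq ?_
      refine (sq_eq_sq₀ (vecNorm_nonneg _) (vecNorm_nonneg _)).1 ?_
      rw [hV.vecNorm_sq_eq, mulVec_mulVec, mulVec_mulVec, hVpA, zero_mulVec, vecNorm_zero]
      ring
    intro x
    have := le_vecNorm_transpose_mulVec_of_square hσ h1 x
    rwa [transpose_mul, transpose_transpose] at this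
  have hS : ‖Vᵀ * U‖ ≤ 3 * u := by
    have := l2_norm_mul_le_of_le ((norm_transpose_eq V).trans_le hVn) hU.norm_le
    linarith
  have hG : ‖(Vᵀ * A) * (Aᵀ * V)‖ ≤ u ^ 2 := by
    have := l2_norm_mul_le_of_le
      (l2_norm_mul_le_of_le ((norm_transpose_eq V).trans_le hVn) hA)
      (l2_norm_mul_le_of_le ((norm_transpose_eq A).trans_le hA) hVn)
    linarith
  have hGσ : ∀ x, σ ^ 2 * vecNorm x ^ 2 ≤ x ⬝ᵥ ((Vᵀ * A) * (Aᵀ * V)) *ᵥ x := fun x => by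
    have := pow_le_pow_left₀ (mul_nonneg hσ.le (vecNorm_nonneg _)) (hAV x) 2
    rw [mul_pow, vecNorm_mulVec_sq, transpose_mul, transpose_transpose] at this
    exact this
  obtain ⟨h1, h2⟩ := hsc.step hs hsσ hρs hρ hd hU.le_vecNorm hS hN hRS hT hR
    (by simp only [transpose_mul, transpose_transpose]) hG hGσ
    (norm_sandwich_le hVn hVn hD) (norm_sandwich_le hVn hVpn hD)
    (norm_sandwich_le hVpn hVn hD) (norm_sandwich_le hVpn hVpn hD)
    (S' := Vᵀ * U') (N' := Vpᵀ * U')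
    (by
      rw [hblock V, hAVp, Matrix.mul_zero, zero_sub, neg_add_eq_sub])
    (by
      rw [hblock Vp, hVpA, Matrix.zero_mul, Matrix.zero_mul, zero_sub, zero_sub, neg_add_eq_sub,
        neg_add_eq_sub])
  refine ⟨?_, h1, h2⟩
  rw [hU']
  refine norm_add_smul_sub_mul_le hsc.μ_pos.le hu.le (by linarith [hsc.μ_u2]) hU.norm_le ?_
  have h3 := norm_add_le_add
    (l2_norm_mul_le_of_le hA ((norm_transpose_eq A).trans_le hA)) hD
  have h4 : σ ^ 2 * τ ≤ u ^ 2 * 1 := by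
    have := hsc.σ_le
    have := hsc.τ_le
    have := hsc.τ_nonneg
    gcongr
    linarith
  linarith [sq_nonneg u]

/-! ### Angles between the signal space and the column space -/

lemma eq_of_mul_eq_mul_of_le {k l : ℕ} {B C : Matrix (Fin l) (Fin k) ℝ}
    {Z : Matrix (Fin k) (Fin k) ℝ} {c : ℝ} (hc : 0 < c)
    (hZ : ∀ x, c * vecNorm x ≤ vecNorm (Z *ᵥ x)) (h : B * Z = C * Z) : B = C := by
  refine ext_of_mulVec_single fun i => ?_
  obtain ⟨x, hx⟩ := mulVec_surjective_of_le hc hZ (Pi.single i 1)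
  rw [← hx, mulVec_mulVec, mulVec_mulVec, h]

lemma vecNorm_mulVec_eq {n k : ℕ} {Q : Matrix (Fin n) (Fin k) ℝ} (hQ : Qᵀ * Q = 1)
    (x : Fin k → ℝ) : vecNorm (Q *ᵥ x) = vecNorm x := by
  refine (sq_eq_sq₀ (vecNorm_nonneg _) (vecNorm_nonneg _)).1 ?_
  rw [vecNorm_mulVec_sq, hQ, one_mulVec, vecNorm_sq]

section Angle

variable {n a q r k : ℕ} {V : Matrix (Fin n) (Fin a) ℝ} {Vp : Matrix (Fin n) (Fin q) ℝ}
  {u τ s ρ s₀ γ : ℝ} {U : Matrix (Fin n) (Fin r) ℝ} {W : Matrix (Fin r) (Fin a) ℝ}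
  {Wp : Matrix (Fin r) (Fin k) ℝ} {Q : Matrix (Fin n) (Fin a) ℝ}

lemma vecNorm_transpose_mulVec_eq {S : Matrix (Fin a) (Fin r) ℝ} (hW : Wᵀ * W = 1)
    (hS : S * (W * Wᵀ) = S) (x : Fin a → ℝ) : vecNorm (Sᵀ *ᵥ x) = vecNorm ((S * W)ᵀ *ᵥ x) := by
  rw [← vecNorm_mulVec_eq hW ((S * W)ᵀ *ᵥ x), mulVec_mulVec]
  congr 2
  rw [← transpose_transpose W, ← transpose_mul, transpose_transpose, Matrix.mul_assoc, hS]

lemma mul_eq_zero_of_transpose_mul_eq_zero {S : Matrix (Fin a) (Fin r) ℝ} (hW : Wᵀ * Wp = 0)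
    (hS : S * (W * Wᵀ) = S) : S * Wp = 0 := by
  rw [← hS, Matrix.mul_assoc, Matrix.mul_assoc, hW, Matrix.mul_zero, Matrix.mul_zero]

/-- A split of `U` controls the residual in directions orthogonal to `W` and the sine of the angle
between the column space of `U * W` and the signal space. -/
lemma SignalSplit.norm_mul_le_and_norm_transpose_mul_le (hU : SignalSplit V Vp u τ s ρ U)
    (hV : IsOrthoSplit V Vp) (hs : 0 < s) (hs₀ : 0 ≤ s₀) (hτ : τ ^ 2 = s₀ ^ 2 * (1 + τ ^ 2))
    (hW : Wᵀ * W = 1) (hUW : Vᵀ * U * (W * Wᵀ) = Vᵀ * U) (hWp : Wpᵀ * Wp = 1)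
    (hWWp : Wᵀ * Wp = 0) (hQ : Qᵀ * Q = 1) (hQU : Q * Qᵀ * (U * W) = U * W) :
    ‖U * Wp‖ ≤ ρ ∧ ‖Vpᵀ * Q‖ ≤ s₀ := by
  obtain ⟨T, R, hN, hRS, hT, hR⟩ := hU.exists_split
  have hSW := mul_eq_zero_of_transpose_mul_eq_zero hWWp hUW
  constructor
  · have h1 : U * Wp = Vp * (R * Wp) := by
      rw [hV.eq_add (U * Wp), ← Matrix.mul_assoc Vᵀ, ← Matrix.mul_assoc Vpᵀ, hN, hSW,
        Matrix.add_mul, Matrix.mul_assoc T, hSW, Matrix.mul_zero, Matrix.mul_zero, zero_add,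
        zero_add]
    rw [h1]
    have := l2_norm_mul_le_of_le hV.norm_right_le
      (l2_norm_mul_le_of_le hR (norm_le_one_of_transpose_mul_self hWp))
    linarith
  · have hAt : ∀ x, s * vecNorm x ≤ vecNorm ((Vᵀ * U * W)ᵀ *ᵥ x) := fun x =>
      (hU.le_vecNorm x).trans_eq (vecNorm_transpose_mulVec_eq hW hUW x)
    have hA := le_vecNorm_transpose_mulVec_of_square hs hAt
    rw [transpose_transpose] at hA
    have hRW : R * W = 0 := by
      refine eq_of_mul_eq_mul_of_le hs hAt ?_
      rw [Matrix.zero_mul, transpose_mul, Matrix.mul_assoc, ← Matrix.mul_assoc W, ← hRS]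
      congr 1
      rw [← transpose_transpose (W * Wᵀ), ← transpose_mul, transpose_mul W, transpose_transpose,
        hUW]
    have hVA : Vᵀ * U * W = Vᵀ * Q * (Qᵀ * (U * W)) := by
      rw [Matrix.mul_assoc, Matrix.mul_assoc, ← Matrix.mul_assoc Q, hQU]
    have hZ : ∀ x, s * vecNorm x ≤ vecNorm ((Qᵀ * (U * W)) *ᵥ x) := fun x => by
      refine (hA x).trans ?_
      rw [hVA, ← mulVec_mulVec]
      have := vecNorm_mulVec_le_of_le (l2_norm_mul_le_of_le
        ((norm_transpose_eq V).trans_le hV.norm_left_le) (norm_le_one_of_transpose_mul_self hQ))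
        ((Qᵀ * (U * W)) *ᵥ x)
      linarith
    have hVpQ : Vpᵀ * Q = T * (Vᵀ * Q) := by
      refine eq_of_mul_eq_mul_of_le hs hZ ?_
      rw [Matrix.mul_assoc T, ← hVA, Matrix.mul_assoc, ← Matrix.mul_assoc Q, hQU,
        ← Matrix.mul_assoc, hN, Matrix.add_mul, hRW, add_zero, Matrix.mul_assoc]
    refine norm_le_of_vecNorm_le hs₀ fun z => ?_
    refine (sq_le_sq₀ (vecNorm_nonneg _) (mul_nonneg hs₀ (vecNorm_nonneg z))).1 ?_
    have h1 := hV.vecNorm_sq_eq (Q *ᵥ z)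
    rw [vecNorm_mulVec_eq hQ, mulVec_mulVec, mulVec_mulVec] at h1
    have h2 : vecNorm ((Vpᵀ * Q) *ᵥ z) ≤ τ * vecNorm ((Vᵀ * Q) *ᵥ z) := by
      rw [hVpQ, ← mulVec_mulVec]
      exact vecNorm_mulVec_le_of_le hT _
    have h3 := pow_le_pow_left₀ (vecNorm_nonneg _) h2 2
    rw [mul_pow] at h3 ⊢
    refine le_of_mul_le_mul_right ?_ (by positivity : 0 < 1 + τ ^ 2)
    calc vecNorm ((Vpᵀ * Q) *ᵥ z) ^ 2 * (1 + τ ^ 2)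
        ≤ τ ^ 2 * vecNorm z ^ 2 := by rw [h1]; linarith
      _ = s₀ ^ 2 * vecNorm z ^ 2 * (1 + τ ^ 2) := by
        conv_lhs => rw [hτ]
        ring

lemma SignalSplit.of_le (hV : IsOrthoSplit V Vp) (hγ : 0 < γ) (hs₀ : 0 ≤ s₀) (hs₀1 : s₀ ≤ 1 / 2)
    (hτ0 : 0 ≤ τ) (hτ : τ ^ 2 = s₀ ^ 2 * (1 + τ ^ 2))
    (hW : Wᵀ * W = 1) (hUW : Vᵀ * U * (W * Wᵀ) = Vᵀ * U) (hWp : Wpᵀ * Wp = 1)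
    (hWWp : Wᵀ * Wp = 0) (hsum : W * Wᵀ + Wp * Wpᵀ = 1) (hQ : Qᵀ * Q = 1)
    (hQU : Q * Qᵀ * (U * W) = U * W) (hγU : ∀ x, γ * vecNorm x ≤ vecNorm ((U * W) *ᵥ x))
    (hUWp : ‖U * Wp‖ ≤ ρ) (hu : ‖U‖ ≤ 3 * u) (hVQ : ‖Vpᵀ * Q‖ ≤ s₀) :
    SignalSplit V Vp u τ (1 / 2 * γ) ρ U := by
  have hVpU : ∀ x, vecNorm ((Vpᵀ * (U * W)) *ᵥ x) ≤ s₀ * vecNorm ((U * W) *ᵥ x) := fun x => by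
    have h1 : (Vpᵀ * (U * W)) *ᵥ x = (Vpᵀ * Q) *ᵥ (Qᵀ *ᵥ ((U * W) *ᵥ x)) := by
      rw [mulVec_mulVec, mulVec_mulVec, Matrix.mul_assoc Vpᵀ Q Qᵀ,
        Matrix.mul_assoc Vpᵀ (Q * Qᵀ), hQU]
    rw [h1]
    refine (vecNorm_mulVec_le_of_le hVQ _).trans (mul_le_mul_of_nonneg_left ?_ hs₀)
    have := vecNorm_mulVec_le_of_le
      ((norm_transpose_eq Q).trans_le (norm_le_one_of_transpose_mul_self hQ)) ((U * W) *ᵥ x)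
    linarith
  have hsplit : ∀ x, vecNorm ((U * W) *ᵥ x) ^ 2 =
      vecNorm ((Vᵀ * U * W) *ᵥ x) ^ 2 + vecNorm ((Vpᵀ * (U * W)) *ᵥ x) ^ 2 := fun x => by
    rw [hV.vecNorm_sq_eq, mulVec_mulVec, mulVec_mulVec, Matrix.mul_assoc]
  have hA : ∀ x, 1 / 2 * γ * vecNorm x ≤ vecNorm ((Vᵀ * U * W) *ᵥ x) := fun x => by
    have h1 := vecNorm_nonneg ((U * W) *ᵥ x)
    have h2 : 1 / 2 * vecNorm ((U * W) *ᵥ x) ≤ vecNorm ((Vᵀ * U * W) *ᵥ x) := by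
      refine (sq_le_sq₀ (by positivity) (vecNorm_nonneg _)).1 ?_
      have h3 := pow_le_pow_left₀ (vecNorm_nonneg _)
        ((hVpU x).trans (mul_le_mul_of_nonneg_right hs₀1 h1)) 2
      have := hsplit x
      have := sq_nonneg (vecNorm ((U * W) *ᵥ x))
      rw [mul_pow] at h3 ⊢
      linarith
    linarith [hγU x]
  have hγ2 : 0 < 1 / 2 * γ := by positivity
  have hAt := le_vecNorm_transpose_mulVec_of_square hγ2 hA
  set A := Vᵀ * U * W with hAdef
  have hunit : IsUnit A.det := (isUnit_iff_isUnit_det A).1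
    (mulVec_surjective_iff_isUnit.1 (mulVec_surjective_of_le hγ2 hA))
  set T := Vpᵀ * (U * W) * A⁻¹ with hTdef
  have hTA : T * A = Vpᵀ * (U * W) := nonsing_inv_mul_cancel_right _ _ hunit
  have hSW := mul_eq_zero_of_transpose_mul_eq_zero hWWp hUW
  set R := Vpᵀ * U - T * (Vᵀ * U) with hRdef
  have hRW : R * W = 0 := by
    rw [hRdef, Matrix.sub_mul, Matrix.mul_assoc T, ← hAdef, hTA, Matrix.mul_assoc, sub_self]
  refine ⟨hu, fun x => (hAt x).trans_eq (vecNorm_transpose_mulVec_eq hW hUW x).symm, T, R,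
    by rw [hRdef]; abel, ?_, ?_, ?_⟩
  · rw [← hUW, transpose_mul, transpose_mul W, transpose_transpose, Matrix.mul_assoc W,
      ← Matrix.mul_assoc, hRW, Matrix.zero_mul]
  · refine norm_le_of_vecNorm_le hτ0 fun y => ?_
    obtain ⟨x, rfl⟩ := mulVec_surjective_of_le hγ2 hA y
    rw [mulVec_mulVec, hTA]
    refine (sq_le_sq₀ (vecNorm_nonneg _) (mul_nonneg hτ0 (vecNorm_nonneg _))).1 ?_
    have h1 := pow_le_pow_left₀ (vecNorm_nonneg _) (hVpU x) 2
    rw [mul_pow, hsplit] at h1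
    have h2 := mul_le_mul_of_nonneg_right h1 (by positivity : 0 ≤ 1 + τ ^ 2)
    set e := vecNorm (A *ᵥ x) ^ 2
    set f := vecNorm ((Vpᵀ * (U * W)) *ᵥ x) ^ 2
    have h3 : s₀ ^ 2 * (e + f) * (1 + τ ^ 2) = τ ^ 2 * (e + f) := by
      conv_rhs => rw [hτ]
      ring
    rw [mul_pow]
    linarith
  · have h1 : R = Vpᵀ * (U * Wp) * Wpᵀ := by
      calc R = R * (W * Wᵀ + Wp * Wpᵀ) := by rw [hsum, Matrix.mul_one]
        _ = R * Wp * Wpᵀ := by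
          rw [Matrix.mul_add, ← Matrix.mul_assoc, hRW, Matrix.zero_mul, zero_add,
            Matrix.mul_assoc]
        _ = Vpᵀ * (U * Wp) * Wpᵀ := by
          rw [hRdef, Matrix.sub_mul, Matrix.mul_assoc T, hSW, Matrix.mul_zero, sub_zero,
            Matrix.mul_assoc Vpᵀ]
    rw [h1]
    have := l2_norm_mul_le_of_le (l2_norm_mul_le_of_le
      ((norm_transpose_eq Vp).trans_le hV.norm_right_le) hUWp)
      ((norm_transpose_eq Wp).trans_le (norm_le_one_of_transpose_mul_self hWp))
    linarith

end Angle

/-! ### The gradient iteration -/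

lemma SignalSplit.norm_residual_le {n m K a q r : ℕ} {δ u τ s ρ : ℝ}
    {V : Matrix (Fin n) (Fin a) ℝ} {Vp : Matrix (Fin n) (Fin q) ℝ} {U : Matrix (Fin n) (Fin r) ℝ}
    {calA : Matrix (Fin n) (Fin n) ℝ →ₗ[ℝ] (Fin m → ℝ)}
    {calAstar : (Fin m → ℝ) →ₗ[ℝ] Matrix (Fin n) (Fin n) ℝ}
    (hU : SignalSplit V Vp u τ s ρ U) (hV : IsOrthoSplit V Vp) (hu : 0 ≤ u) (hτ : τ ≤ 1)
    (hmin : (min r n : ℕ) * ρ ^ 2 ≤ u ^ 2) (h : RIPn calA K δ) (hadj : IsAdjointPair' calA calAstar)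
    (hδ : 0 ≤ δ) (ha : 1 ≤ a) (hK : 2 ≤ K) (haK : a + 1 ≤ K) {A : Matrix (Fin n) (Fin a) ℝ}
    (hA : ‖A‖ ≤ u) :
    ‖calAstar (calA (A * Aᵀ - U * Uᵀ)) - (A * Aᵀ - U * Uᵀ)‖ ≤
      δ * (Real.sqrt a * (38 * u ^ 2)) := by
  obtain ⟨T, R, hN, hRS, hT, hR⟩ := hU.exists_split
  have hUL : U = (V + Vp * T) * (Vᵀ * U) + Vp * R := by
    conv_lhs => rw [hV.eq_add U, hN]
    rw [Matrix.add_mul, Matrix.mul_add, Matrix.mul_assoc Vp T]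
    abel
  have hL : ‖V + Vp * T‖ ≤ 2 := by
    have := norm_add_le_add hV.norm_left_le
      (l2_norm_mul_le_of_le hV.norm_right_le (hT.trans hτ))
    linarith
  have hS : ‖Vᵀ * U‖ ≤ 3 * u := by
    have := l2_norm_mul_le_of_le ((norm_transpose_eq V).trans_le hV.norm_left_le) hU.norm_le
    linarith
  have hVpR : ‖Vp * R‖ ≤ ρ := by
    have := l2_norm_mul_le_of_le hV.norm_right_le hR
    linarith
  refine (h.norm_residual_le hadj hδ hK haK A (V + Vp * T) hUL
    (by rw [Matrix.mul_assoc, hRS, Matrix.mul_zero])).trans (mul_le_mul_of_nonneg_left ?_ hδ)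
  have hsqrt : 1 ≤ Real.sqrt a := Real.one_le_sqrt.2 (by exact_mod_cast ha)
  calc Real.sqrt a * (‖A‖ * ‖A‖) +
        Real.sqrt a * (‖V + Vp * T‖ * (‖Vᵀ * U‖ * ‖Vᵀ * U‖ * ‖V + Vp * T‖)) +
        (min r n : ℕ) * ‖Vp * R‖ ^ 2
      ≤ Real.sqrt a * (u * u) + Real.sqrt a * (2 * (3 * u * (3 * u) * 2)) +
        (min r n : ℕ) * ρ ^ 2 := by gcongr
    _ ≤ Real.sqrt a * (u * u) + Real.sqrt a * (2 * (3 * u * (3 * u) * 2)) +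
        Real.sqrt a * u ^ 2 := by
      have := hmin.trans (le_mul_of_one_le_left (sq_nonneg u) hsqrt)
      linarith
    _ = Real.sqrt a * (38 * u ^ 2) := by ring

lemma exists_tangent {s₀ : ℝ} (h0 : 0 ≤ s₀) (h1 : s₀ ≤ 1 / 2) :
    ∃ τ, s₀ ≤ τ ∧ τ ≤ 2 * s₀ ∧ τ ^ 2 = s₀ ^ 2 * (1 + τ ^ 2) := by
  have h2 : 3 / 4 ≤ 1 - s₀ ^ 2 := by nlinarith
  have h3 : 0 < Real.sqrt (1 - s₀ ^ 2) := Real.sqrt_pos.2 (by linarith)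
  have h4 : Real.sqrt (1 - s₀ ^ 2) ^ 2 = 1 - s₀ ^ 2 := Real.sq_sqrt (by linarith)
  refine ⟨s₀ / Real.sqrt (1 - s₀ ^ 2), ?_, ?_, ?_⟩
  · rw [le_div_iff₀ h3]
    exact mul_le_of_le_one_right h0 (Real.sqrt_le_one.2 (by nlinarith))
  · rw [div_le_iff₀ h3]
    have : 1 / 2 ≤ Real.sqrt (1 - s₀ ^ 2) := Real.le_sqrt_of_sq_le (by linarith)
    nlinarith
  · rw [div_pow, h4]
    have : 1 - s₀ ^ 2 ≠ 0 := by linarith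
    field_simp
    ring

lemma StepScalars.of_le {μ σ u τ : ℝ} (hμ : 0 < μ) (hσ : 0 < σ) (hσu : σ ≤ u) (hτ0 : 0 ≤ τ)
    (hτ : τ ≤ 2 / 10 ^ 4 * ((u / σ) ^ 2)⁻¹)
    (hμu : μ ≤ 1 / 10 ^ 11 * ((u / σ) ^ 2)⁻¹ * (u ^ 2)⁻¹) : StepScalars μ σ u τ := by
  have hu : 0 < u := hσ.trans_le hσu
  have hu2 : 0 < u ^ 2 := by positivity
  have hle : σ ^ 2 ≤ u ^ 2 := pow_le_pow_left₀ hσ.le hσu 2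
  have hκ : ((u / σ) ^ 2)⁻¹ = σ ^ 2 / u ^ 2 := by rw [div_pow, inv_div]
  rw [hκ] at hτ hμu
  have hle1 : σ ^ 2 / u ^ 2 ≤ 1 := (div_le_one hu2).2 hle
  have h1 : μ * u ^ 2 ≤ 1 / 10 ^ 11 * (σ ^ 2 / u ^ 2) := by
    have := mul_le_mul_of_nonneg_right hμu hu2.le
    rwa [mul_assoc, inv_mul_cancel₀ hu2.ne', mul_one] at this
  have h2 : σ ^ 2 / u ^ 2 * u ^ 2 = σ ^ 2 := div_mul_cancel₀ _ hu2.ne'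
  refine ⟨hμ, hσ, hσu, hτ0, by linarith, by linarith, ?_, ?_⟩
  · have := mul_le_mul_of_nonneg_right h1 hu2.le
    have := sq_nonneg σ
    nlinarith
  · have := mul_le_mul_of_nonneg_right hτ hu2.le
    nlinarith

/-- The schedules `s k = γ (1 + x)ᵏ / 2` and `ρ k = 2 γ (1 + w)ᵏ` for signal and residual stay
compatible as long as the signal is small. -/
lemma schedule_bounds {x w γ σ u N : ℝ} (hw : 0 ≤ w) (hwx : w ≤ 1 / 10 * x) (hx : x ≤ 1)
    (hγ : 0 < γ) (hσ : 0 < σ) (hσu : σ ≤ u) (hN : 1 ≤ N)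
    (hγσ : γ ≤ 1 / 10 ^ 6 * σ / (N * (u / σ) ^ 2)) (k : ℕ)
    (hs : 10 * (1 / 2 * (1 + x) ^ k * γ) ^ 2 ≤ σ ^ 2) :
    2 * (1 + w) ^ k * γ ≤ 4 * (1 / 2 * (1 + x) ^ k * γ) ∧
      (2 * (1 + w) ^ k * γ) ^ 2 ≤ 1 / 10 ^ 5 * σ ^ 2 ∧ N * (2 * (1 + w) ^ k * γ) ^ 2 ≤ u ^ 2 := by
  have hx0 : 0 ≤ x := by linarith
  have hpow : (1 + w) ^ k ≤ (1 + x) ^ k := by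
    gcongr
    linarith
  have hpow2 : ((1 + w) ^ k) ^ 2 ≤ (1 + x) ^ k := by
    rw [← pow_mul, mul_comm, pow_mul]
    gcongr
    nlinarith
  have hκ : 1 ≤ (u / σ) ^ 2 := one_le_pow₀ ((one_le_div hσ).2 hσu)
  have hγ1 : N * γ ≤ 1 / 10 ^ 6 * σ := by
    rw [le_div_iff₀ (by positivity)] at hγσ
    refine le_trans ?_ hγσ
    have : N * γ * 1 ≤ N * γ * (u / σ) ^ 2 := by gcongr
    linarith
  have hs1 : 1 / 2 * (1 + x) ^ k * γ ≤ 1 / 3 * σ := by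
    refine (sq_le_sq₀ (by positivity) (by positivity)).1 ?_
    nlinarith
  have hρ : N * (2 * (1 + w) ^ k * γ) ^ 2 ≤ 1 / 10 ^ 5 * σ ^ 2 := by
    calc N * (2 * (1 + w) ^ k * γ) ^ 2 = 4 * ((1 + w) ^ k) ^ 2 * γ * (N * γ) := by ring
      _ ≤ 4 * (1 + x) ^ k * γ * (1 / 10 ^ 6 * σ) := by gcongr
      _ = 8 * (1 / 2 * (1 + x) ^ k * γ) * (1 / 10 ^ 6 * σ) := by ring
      _ ≤ 8 * (1 / 3 * σ) * (1 / 10 ^ 6 * σ) := by gcongr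
      _ ≤ 1 / 10 ^ 5 * σ ^ 2 := by nlinarith [sq_nonneg σ]
  refine ⟨?_, le_trans (le_mul_of_one_le_left (sq_nonneg _) hN) hρ, hρ.trans ?_⟩
  · have := mul_le_mul_of_nonneg_right hpow hγ.le
    linarith
  · have : σ ^ 2 ≤ u ^ 2 := pow_le_pow_left₀ hσ.le hσu 2
    linarith [sq_nonneg u]

lemma add_one_le_of_pow_mul_lt {x γ σ : ℝ} (hx : 0 < x) (hx1 : x ≤ 1) (hγ : 0 < γ) (k : ℕ)
    (h : 1 / 2 * (1 + x) ^ k * γ < σ / Real.sqrt 10) :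
    (k : ℝ) + 1 ≤ 2 / x * Real.log (Real.sqrt (5 / 2) * σ / γ) := by
  have h10 : 0 < Real.sqrt 10 := by positivity
  have h5 : Real.sqrt (5 / 2) * Real.sqrt 10 = 5 := by
    rw [← Real.sqrt_mul (by norm_num)]
    have : (5 / 2 * 10 : ℝ) = 5 ^ 2 := by norm_num
    rw [this, Real.sqrt_sq (by norm_num)]
  have h1 : (1 + x) ^ k * (5 / 2) ≤ Real.sqrt (5 / 2) * σ / γ := by
    rw [le_div_iff₀ hγ]
    have h2 := (mul_lt_mul_of_pos_right h (by norm_num : (0 : ℝ) < 5)).le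
    have h3 : σ / Real.sqrt 10 * 5 = Real.sqrt (5 / 2) * σ := by
      rw [div_mul_eq_mul_div, div_eq_iff h10.ne', mul_right_comm, h5, mul_comm]
    linarith
  have h2 := Real.log_le_log (by positivity) h1
  rw [Real.log_mul (by positivity) (by norm_num), Real.log_pow] at h2
  have h3 : x / 2 ≤ Real.log (1 + x) := by
    refine le_trans ?_ (Real.le_log_one_add_of_nonneg hx.le)
    rw [div_le_div_iff₀ (by norm_num) (by linarith)]
    nlinarith
  have h4 : 1 / 2 ≤ Real.log (5 / 2) := by
    have := Real.log_le_log (by norm_num : (0 : ℝ) < 2) (by norm_num : (2 : ℝ) ≤ 5 / 2)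
    linarith [Real.log_two_gt_d9]
  have h6 := mul_le_mul_of_nonneg_left h3 (Nat.cast_nonneg k)
  rw [div_mul_eq_mul_div, le_div_iff₀ hx]
  linarith

lemma mul_eq_self_of_mul_mul_transpose {n k l : ℕ} {V : Matrix (Fin n) (Fin k) ℝ}
    {A : Matrix (Fin n) (Fin l) ℝ} (h : V * Vᵀ * (A * Aᵀ) = A * Aᵀ) : V * Vᵀ * A = A := by
  have h1 : (V * Vᵀ * A - A) * (V * Vᵀ * A - A)ᴴ = 0 := by
    have h2 : (V * Vᵀ * A - A) * Aᵀ = 0 := by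
      rw [Matrix.sub_mul, Matrix.mul_assoc _ A, h, sub_self]
    rw [conjTranspose_eq_transpose_of_trivial, transpose_sub, transpose_mul, Matrix.mul_sub, h2,
      ← Matrix.mul_assoc, h2, Matrix.zero_mul, sub_zero]
  exact sub_eq_zero.1 (self_mul_conjTranspose_eq_zero.1 h1)

end Auxiliary

/-- signal-increasing phase. -/
theorem signal_increasing_phase :
    ∃ c c1 c2 : ℝ, 0 < c ∧ 0 < c1 ∧ 0 < c2 ∧
      ∀ (n m r rstar : ℕ)
        (Unat : Matrix (Fin n) (Fin rstar) ℝ) (Xnat : Matrix (Fin n) (Fin n) ℝ),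
        Xnat = Unat * Unatᵀ → Xnat.rank = rstar →
        ∀ (kappaf : ℝ), kappaf = specNorm Unat / singVal Unat rstar →
        ∀ (calA : Matrix (Fin n) (Fin n) ℝ →ₗ[ℝ] (Fin m → ℝ))
          (calAstar : (Fin m → ℝ) →ₗ[ℝ] Matrix (Fin n) (Fin n) ℝ),
        IsAdjointPair' calA calAstar →
        ∀ (δ : ℝ), RIPn calA (2 * rstar) δ →
        δ ≤ c * (kappaf ^ 4)⁻¹ * (Real.sqrt rstar)⁻¹ →
        ∀ (E : Matrix (Fin n) (Fin n) ℝ),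
        specNorm E ≤ c * (kappaf ^ 2)⁻¹ * singVal Xnat rstar →
        ∀ (μ : ℝ), 0 < μ → μ ≤ c * (kappaf ^ 2)⁻¹ * (specNorm Unat ^ 2)⁻¹ →
        rstar ≤ r →
        -- the gradient descent iterates
        ∀ (Useq : ℕ → Matrix (Fin n) (Fin r) ℝ),
        (∀ t, Useq (t + 1) =
          Useq t + μ • ((calAstar (calA (Xnat - Useq t * (Useq t)ᵀ)) + E) * Useq t)) →
        -- orthonormal bases for the relevant column spaces
        ∀ (VX : Matrix (Fin n) (Fin rstar) ℝ)
          (VXperp : Matrix (Fin n) (Fin (n - rstar)) ℝ),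
        VXᵀ * VX = 1 → VX * VXᵀ * Xnat = Xnat →
        VXperpᵀ * VXperp = 1 → VX * VXᵀ + VXperp * VXperpᵀ = 1 →
        ∀ (W : ℕ → Matrix (Fin r) (Fin rstar) ℝ)
          (Wperp : ℕ → Matrix (Fin r) (Fin (r - rstar)) ℝ)
          (VUW : ℕ → Matrix (Fin n) (Fin rstar) ℝ),
        (∀ t, (W t)ᵀ * W t = 1 ∧ VXᵀ * Useq t * (W t * (W t)ᵀ) = VXᵀ * Useq t) →
        (∀ t, (Wperp t)ᵀ * Wperp t = 1 ∧ (W t)ᵀ * Wperp t = 0 ∧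
          W t * (W t)ᵀ + Wperp t * (Wperp t)ᵀ = 1) →
        (∀ t, (VUW t)ᵀ * VUW t = 1 ∧
          VUW t * (VUW t)ᵀ * (Useq t * W t) = Useq t * W t) →
        -- assumptions at time t⋆
        ∀ (γ : ℝ) (tstar : ℕ),
        0 < γ →
        γ ≤ singVal (Useq tstar * W tstar) rstar →
        specNorm (Useq tstar * Wperp tstar) ≤ 2 * γ →
        specNorm (Useq tstar) ≤ 3 * specNorm Unat →
        γ ≤ c1 * singVal Unat rstar / ((min r n : ℕ) * kappaf ^ 2) →
        specNorm (VXperpᵀ * VUW tstar) ≤ c2 * (kappaf ^ 2)⁻¹ →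
        -- conclusion: t₁ (the first time the signal is large) is finite and
        -- the four inequalities hold on [t⋆, t₁]
        ∃ t1 : ℕ, tstar ≤ t1 ∧
          singVal Unat rstar / Real.sqrt 10 ≤ singVal (VXᵀ * Useq t1) rstar ∧
          (∀ t, tstar ≤ t → t < t1 →
            singVal (VXᵀ * Useq t) rstar < singVal Unat rstar / Real.sqrt 10) ∧
          ((t1 - tstar : ℕ) : ℝ) ≤ 16 / (μ * singVal Unat rstar ^ 2) *
            Real.log (Real.sqrt (5 / 2) * singVal Unat rstar / γ) ∧
          ∀ t, tstar ≤ t → t ≤ t1 →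
            1 / 2 * (1 + 1 / 8 * μ * singVal Unat rstar ^ 2) ^ (t - tstar) * γ ≤
                singVal (VXᵀ * Useq t) rstar ∧
              specNorm (Useq t * Wperp t) ≤
                2 * (1 + 80 * μ * c2 * singVal Unat rstar ^ 2) ^ (t - tstar) * γ ∧
              specNorm (Useq t) ≤ 3 * specNorm Unat ∧
              specNorm (VXperpᵀ * VUW t) ≤ c2 * (kappaf ^ 2)⁻¹ := by
  open scoped Matrix.Norms.L2Operator in
  refine ⟨1 / 10 ^ 11, 1 / 10 ^ 6, 1 / 10 ^ 4, by norm_num, by norm_num, by norm_num, ?_⟩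
  rintro n m r a A X rfl - κ rfl calA calAstar hadj δ hRIP hδ E hE μ hμ hμu har U hUstep V Vp
    hVV hVX hVp hVsum W Wp Q hW hWp hQ γ t₀ hγ hγU hUWp hU3 hγσ hVQ
  have hV : IsOrthoSplit V Vp := ⟨hVV, hVp, hVsum⟩
  have ha : 0 < a := by
    refine Nat.pos_of_ne_zero fun h => ?_
    subst h
    rw [singVal_zero] at hγU
    linarith
  have hσA := singVal_mul_vecNorm_le A
  have hXσ := singVal_mul_transpose_le A ha
  have hσ0 := singVal_nonneg A a
  have hγUx : ∀ x, γ * vecNorm x ≤ vecNorm ((U t₀ * W t₀) *ᵥ x) := fun x =>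
    (mul_le_mul_of_nonneg_right hγU (vecNorm_nonneg x)).trans (singVal_mul_vecNorm_le _ x)
  have hσu : singVal A a ≤ specNorm A := by
    rw [specNorm_eq_norm]
    exact le_norm_of_finrank ha (V := ⊤) (by simp) fun x _ => hσA x
  have hAu : ‖A‖ ≤ specNorm A := (specNorm_eq_norm A).ge
  have hnU : ∀ t, specNorm (U t) = ‖U t‖ := fun t => specNorm_eq_norm _
  have hnUW : ∀ t, specNorm (U t * Wp t) = ‖U t * Wp t‖ := fun t => specNorm_eq_norm _
  have hnVQ : ∀ t, specNorm (Vpᵀ * Q t) = ‖Vpᵀ * Q t‖ := fun t => specNorm_eq_norm _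
  simp only [hnU, hnUW, hnVQ] at hUWp hU3 hVQ ⊢
  rw [specNorm_eq_norm E] at hE
  set σ := singVal A a with hσdef
  set u := specNorm A with hudef
  have hσ : 0 < σ := by
    refine hσ0.lt_of_ne fun h => ?_
    rw [← h, mul_zero, zero_div] at hγσ
    linarith
  have hu : 0 < u := hσ.trans_le hσu
  have hκ : 1 ≤ (u / σ) ^ 2 := one_le_pow₀ ((one_le_div hσ).2 hσu)
  have hκu : ((u / σ) ^ 2)⁻¹ * u ^ 2 = σ ^ 2 := by
    field_simp
  have hN : (1 : ℝ) ≤ (min r n : ℕ) := by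
    rcases Nat.eq_zero_or_pos (min r n) with h | h
    · rw [h, Nat.cast_zero, zero_mul, div_zero] at hγσ
      linarith
    · exact_mod_cast h
  have hγσ' : γ ≤ σ := by
    refine hγσ.trans ?_
    rw [div_le_iff₀ (by positivity)]
    have : 1 ≤ (min r n : ℕ) * (u / σ) ^ 2 := one_le_mul_of_one_le_of_one_le hN hκ
    nlinarith
  have hn : 0 < n := by
    have : 0 < min r n := by exact_mod_cast hN
    omega
  have hδ0 : 0 ≤ δ := hRIP.nonneg hn (by omega)
  have hκinv : ((u / σ) ^ 2)⁻¹ ≤ 1 := inv_le_one_of_one_le₀ hκ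
  obtain ⟨τ, hsτ, hτs, hτ⟩ := exists_tangent (s₀ := 1 / 10 ^ 4 * ((u / σ) ^ 2)⁻¹)
    (by positivity) (by linarith)
  have hτ0 : 0 ≤ τ := le_trans (by positivity) hsτ
  have hsc : StepScalars μ σ u τ := .of_le hμ hσ hσu hτ0 (by linarith) hμu
  have hVA : V * Vᵀ * A = A := mul_eq_self_of_mul_mul_transpose hVX
  have hd : δ * (Real.sqrt a * (38 * u ^ 2)) + ‖E‖ ≤ 1 / 10 ^ 5 * (σ ^ 2 * τ) := by
    have hsqrt : 0 < Real.sqrt a := Real.sqrt_pos.2 (by exact_mod_cast ha)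
    have h1 : δ * Real.sqrt a ≤ 1 / 10 ^ 11 * ((u / σ) ^ 4)⁻¹ := by
      have := mul_le_mul_of_nonneg_right hδ hsqrt.le
      rwa [mul_assoc _ _ (Real.sqrt a), inv_mul_cancel₀ hsqrt.ne', mul_one] at this
    have h2 : ((u / σ) ^ 4)⁻¹ * u ^ 2 = ((u / σ) ^ 2)⁻¹ * σ ^ 2 := by
      rw [← hκu]
      field_simp
    have h3 := mul_le_mul_of_nonneg_right h1 (by positivity : 0 ≤ 38 * u ^ 2)
    have h4 : ‖E‖ ≤ 1 / 10 ^ 11 * ((u / σ) ^ 2)⁻¹ * σ ^ 2 := hE.trans (by gcongr)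
    have h5 := mul_le_mul_of_nonneg_right hsτ (sq_nonneg σ)
    generalize ((u / σ) ^ 4)⁻¹ = p at h2 h3
    generalize ((u / σ) ^ 2)⁻¹ = q at h2 h4 h5
    linarith [mul_nonneg hτ0 (sq_nonneg σ)]
  have hx0 : 0 < 1 / 8 * μ * σ ^ 2 := by positivity
  have hμσ : μ * σ ^ 2 ≤ 1 / 10 ^ 5 := le_trans (by gcongr) hsc.μ_u2
  have hsplit : ∀ k : ℕ, (∀ j < k, singVal (Vᵀ * U (t₀ + j)) a < σ / Real.sqrt 10) →
      SignalSplit V Vp u τ (1 / 2 * (1 + 1 / 8 * μ * σ ^ 2) ^ k * γ)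
        (2 * (1 + 80 * μ * (1 / 10 ^ 4) * σ ^ 2) ^ k * γ) (U (t₀ + k)) := by
    intro k
    induction k with
    | zero =>
      intro _
      simpa using SignalSplit.of_le hV hγ (by positivity) (by linarith) hτ0 hτ (hW t₀).1 (hW t₀).2
        (hWp t₀).1 (hWp t₀).2.1 (hWp t₀).2.2 (hQ t₀).1 (hQ t₀).2 hγUx hUWp hU3 hVQ
    | succ k ih =>
      intro hk
      have hS := ih fun j hj => hk j (hj.trans k.lt_succ_self)
      have hs : 0 < 1 / 2 * (1 + 1 / 8 * μ * σ ^ 2) ^ k * γ := by positivity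
      have hsσ : 10 * (1 / 2 * (1 + 1 / 8 * μ * σ ^ 2) ^ k * γ) ^ 2 ≤ σ ^ 2 := by
        have h1 := (le_singVal_of_transpose ha hs hS.le_vecNorm).trans (hk k k.lt_succ_self).le
        have h2 := pow_le_pow_left₀ hs.le h1 2
        rw [div_pow, Real.sq_sqrt (by norm_num), le_div_iff₀ (by norm_num)] at h2
        linarith
      obtain ⟨hρs, hρ, hNρ⟩ := schedule_bounds (w := 80 * μ * (1 / 10 ^ 4) * σ ^ 2) (by positivity)
        (by linarith) (by linarith) hγ hσ hσu hN hγσ k hsσ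
      have hres := hS.norm_residual_le hV hu.le (hsc.τ_le.trans (by norm_num)) hNρ hRIP hadj hδ0
        ha (by omega) (by omega) hAu
      have := hS.step hV hsc hs hsσ hρs hρ hd hAu hVA hσA (norm_add_le_add hres le_rfl)
        (U' := U (t₀ + k + 1)) (by
          rw [hUstep]
          congr 3
          abel)
      convert this using 1
      · ring
      · ring
      · rfl
  have hle : ∀ k : ℕ, (∀ j < k, singVal (Vᵀ * U (t₀ + j)) a < σ / Real.sqrt 10) →
      1 / 2 * (1 + 1 / 8 * μ * σ ^ 2) ^ k * γ ≤ singVal (Vᵀ * U (t₀ + k)) a := fun k hk =>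
    le_singVal_of_transpose ha (by positivity) (hsplit k hk).le_vecNorm
  have htime : ∀ k : ℕ, (∀ j < k + 1, singVal (Vᵀ * U (t₀ + j)) a < σ / Real.sqrt 10) →
      (k : ℝ) + 1 ≤ 16 / (μ * σ ^ 2) * Real.log (Real.sqrt (5 / 2) * σ / γ) := by
    intro k hk
    have h1 := add_one_le_of_pow_mul_lt hx0 (by linarith) hγ k
      ((hle k fun j hj => hk j (hj.trans k.lt_succ_self)).trans_lt (hk k k.lt_succ_self))
    have h2 : 2 / (1 / 8 * μ * σ ^ 2) = 16 / (μ * σ ^ 2) := by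
      field_simp
      norm_num
    rwa [h2] at h1
  have hex : ∃ k : ℕ, σ / Real.sqrt 10 ≤ singVal (Vᵀ * U (t₀ + k)) a := by
    by_contra! hcon
    obtain ⟨k, hk⟩ := exists_nat_gt (16 / (μ * σ ^ 2) * Real.log (Real.sqrt (5 / 2) * σ / γ))
    linarith [htime k fun j _ => hcon j]
  classical
  have hmin : ∀ j < Nat.find hex, singVal (Vᵀ * U (t₀ + j)) a < σ / Real.sqrt 10 := fun j hj =>
    not_le.1 (Nat.find_min hex hj)
  refine ⟨t₀ + Nat.find hex, Nat.le_add_right _ _, Nat.find_spec hex, ?_, ?_, ?_⟩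
  · intro t ht ht'
    obtain ⟨j, rfl⟩ := Nat.exists_eq_add_of_le ht
    exact hmin j (by omega)
  · rw [Nat.add_sub_cancel_left]
    rcases h : Nat.find hex with _ | k
    · rw [Nat.cast_zero]
      refine mul_nonneg (by positivity) (Real.log_nonneg ?_)
      rw [one_le_div hγ]
      have : 1 ≤ Real.sqrt (5 / 2) := Real.one_le_sqrt.2 (by norm_num)
      nlinarith
    · rw [Nat.cast_succ]
      rw [h] at hmin
      exact htime k hmin
  · intro t ht ht'
    obtain ⟨k, rfl⟩ := Nat.exists_eq_add_of_le ht
    have hk : ∀ j < k, singVal (Vᵀ * U (t₀ + j)) a < σ / Real.sqrt 10 := fun j hj =>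
      hmin j (by omega)
    have hS := hsplit k hk
    obtain ⟨h1, h2⟩ := hS.norm_mul_le_and_norm_transpose_mul_le hV (by positivity) (by positivity)
      hτ (hW _).1 (hW _).2 (hWp _).1 (hWp _).2.1 (hQ _).1 (hQ _).2
    rw [Nat.add_sub_cancel_left]
    exact ⟨hle k hk, h1, hS.norm_le, h2⟩
end
end
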